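/- arXiv:2603.22240 — 2 statements merged into one kernel-verified Lean document; each statement's English description precedes it below -/
import Mathlib

section
/- Let d ≥ 1. Let C₁ be a caterpillar whose solution-tight packing contains all vertices of C₁, with essence γ₁ and spine v_1,…,v_n, and let C₂ be a caterpillar whose solution-tight packing contains all vertices of C₂, with essence γ₂ and spine w_1,…,w_m. Let C be the caterpillar obtained from the disjoint union of C₁ and C₂ by adding the edge v_n w_1, with spine v_1,…,v_n,w_1,…,w_m. Then the essence γ of C satisfies γ = γ₂ ∘ γ₁. -/
namespace CocPaper

open SimpleGraph

variable {V : Type} {W : Type}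

/-- `S` is a `d`-coc set of the subgraph of `G` induced on the vertex set `A`:
after deleting `S`, every connected component has at most `d` vertices. -/
def IsCocSetOn (G : SimpleGraph V) (A : Set V) (d : ℕ) (S : Set V) : Prop :=
  ∀ c : (G.induce (A \ S)).ConnectedComponent, c.supp.ncard ≤ d

/-- The minimum size of a `d`-coc set of the subgraph of `G` induced on `A`. -/
noncomputable def cocOptOn (G : SimpleGraph V) (A : Set V) (d : ℕ) : ℕ :=
  sInf {m : ℕ | ∃ S : Set V, S ⊆ A ∧ IsCocSetOn G A d S ∧ S.ncard = m}

/-- `S` is a minimum `d`-coc set of the subgraph of `G` induced on `A`. -/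
def IsMinCocSetOn (G : SimpleGraph V) (A : Set V) (d : ℕ) (S : Set V) : Prop :=
  S ⊆ A ∧ IsCocSetOn G A d S ∧ S.ncard = cocOptOn G A d

/-- `X` is a `d`-blocking set of `G[A]`: no minimum `d`-coc set contains `X`. -/
def IsBlockingSetOn (G : SimpleGraph V) (A : Set V) (d : ℕ) (X : Set V) : Prop :=
  ∀ S : Set V, IsMinCocSetOn G A d S → ¬ X ⊆ S

/-- A minimal `d`-blocking set: a `d`-blocking set no proper subset of which is one. -/
def IsMinimalBlockingSetOn (G : SimpleGraph V) (A : Set V) (d : ℕ) (X : Set V) : Prop :=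
  IsBlockingSetOn G A d X ∧ ∀ Y : Set V, Y ⊂ X → ¬ IsBlockingSetOn G A d Y

/-- `G` is (isomorphic to) a path graph, possibly empty. -/
def IsPathGraph (G : SimpleGraph V) : Prop :=
  ∃ n : ℕ, Nonempty (G ≃g SimpleGraph.pathGraph n)

/-- A caterpillar: a tree such that deleting all vertices of degree one yields a
(possibly empty) path. -/
def IsCaterpillar (G : SimpleGraph V) : Prop :=
  G.IsTree ∧ IsPathGraph (G.induce {v : V | (G.neighborSet v).ncard ≠ 1})

/-- A caterpillar forest: every connected component is a caterpillar. -/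
def IsCaterpillarForest (G : SimpleGraph V) : Prop :=
  ∀ c : G.ConnectedComponent, IsCaterpillar (G.induce c.supp)

/-- `G` is (isomorphic to) a cycle graph. -/
def IsCycleGraph (G : SimpleGraph V) : Prop :=
  ∃ n : ℕ, 3 ≤ n ∧ Nonempty (G ≃g SimpleGraph.cycleGraph n)

/-- A connected subgraph of `G` which is a caterpillar, equipped with a fixed
nonempty spine listed in left-to-right order: the spine is a path in `G` inside
`verts`, and every vertex of `verts` off the spine has degree one in the subgraph. -/
structure SubCaterpillar (G : SimpleGraph V) where
  verts : Set V
  n : ℕ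
  npos : 0 < n
  spine : Fin n → V
  spineMem : ∀ i, spine i ∈ verts
  spineInj : Function.Injective spine
  spineAdj : ∀ (i : ℕ) (h : i + 1 < n),
    G.Adj (spine ⟨i, Nat.lt_of_succ_lt h⟩) (spine ⟨i + 1, h⟩)
  isTree : (G.induce verts).IsTree
  pendant : ∀ v ∈ verts, v ∉ Set.range spine → {w : V | w ∈ verts ∧ G.Adj v w}.ncard = 1

/-- The spine position of a vertex of the caterpillar: its spine index if it is a
spine vertex, and the spine index of its parent if it is a pendant. -/
noncomputable def SubCaterpillar.pos {G : SimpleGraph V} (C : SubCaterpillar G) (v : V) : ℕ :=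
  sInf {i : ℕ | ∃ h : i < C.n,
    C.spine ⟨i, h⟩ = v ∨ (v ∉ Set.range C.spine ∧ G.Adj v (C.spine ⟨i, h⟩))}

/-- `P` is a solution-tight packing of the spined caterpillar `C` with respect to `d`.
Packed (induced, connected) subgraphs are represented by their vertex sets. -/
def IsSTP (G : SimpleGraph V) (d : ℕ) (C : SubCaterpillar G) (P : Finset (Set V)) : Prop :=
  (∀ A ∈ P, A ⊆ C.verts ∧ d + 1 ≤ A.ncard ∧ (G.induce A).Connected) ∧
  ((↑P : Set (Set V)).Pairwise fun A B => Disjoint A B) ∧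
  P.card = cocOptOn G C.verts d ∧
  (∀ A ∈ P, ∀ v ∈ C.verts, v ∉ Set.range C.spine → ∀ w ∈ A, G.Adj v w → v ∈ A) ∧
  (∃ i : ℕ, i ≤ C.n ∧ ∀ j : Fin C.n, ((j : ℕ) < i ↔ ∃ A ∈ P, C.spine j ∈ A)) ∧
  (∀ A ∈ P, ∀ j : Fin C.n, C.spine j ∈ A →
    (∀ j' : Fin C.n, C.spine j' ∈ A → (j' : ℕ) ≤ (j : ℕ)) →
    IsCocSetOn G A d {C.spine j})

/-- A caterpillar forest on the vertex set `F` inside the ambient graph `G`,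
with a fixed spine and spine order for each connected component. -/
structure SpinedCatForest (G : SimpleGraph V) (F : Set V) where
  numComps : ℕ
  comp : Fin numComps → SubCaterpillar G
  sub : ∀ c, (comp c).verts ⊆ F
  cover : ∀ v ∈ F, ∃ c, v ∈ (comp c).verts
  disj : ∀ c c', c ≠ c' → Disjoint (comp c).verts (comp c').verts
  noCross : ∀ c c', c ≠ c' → ∀ v ∈ (comp c).verts, ∀ w ∈ (comp c').verts, ¬ G.Adj v w

/-- `P` is a solution-tight packing of the caterpillar forest `𝔉`: the union over the
connected components of solution-tight packings of the components. -/
def IsForestSTP (G : SimpleGraph V) (d : ℕ) {F : Set V} (𝔉 : SpinedCatForest G F)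
    (P : Finset (Set V)) : Prop :=
  ∃ Q : Fin 𝔉.numComps → Finset (Set V),
    (∀ c, IsSTP G d (𝔉.comp c) (Q c)) ∧
    (↑P : Set (Set V)) = ⋃ c, (↑(Q c) : Set (Set V))

/-- Attach `x` new pendant vertices to the vertex `v` of `H`. -/
def attachPendants (H : SimpleGraph W) (v : W) (x : ℕ) : SimpleGraph (W ⊕ Fin x) :=
  SimpleGraph.fromRel fun a b =>
    (∃ u u', a = Sum.inl u ∧ b = Sum.inl u' ∧ H.Adj u u') ∨
    (∃ i : Fin x, a = Sum.inl v ∧ b = Sum.inr i)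

/-- The number of vertices of the connected component of `v` in the graph obtained
from `G[A]` by deleting `S` (this is `0` when `v ∈ S` or `v ∉ A`). -/
noncomputable def compSizeOn (G : SimpleGraph V) (A S : Set V) (v : V) : ℕ :=
  {w : V | ∃ (hv : v ∈ A \ S) (hw : w ∈ A \ S),
    (G.induce (A \ S)).Reachable ⟨v, hv⟩ ⟨w, hw⟩}.ncard

/-- The essence of a spined caterpillar `C` relative to `d`. -/
noncomputable def SubCaterpillar.essence {G : SimpleGraph V} (C : SubCaterpillar G)
    (d : ℕ) : ℕ → ℕ := fun x =>
  let Cx : SimpleGraph (↥C.verts ⊕ Fin x) :=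
    attachPendants (G.induce C.verts) ⟨C.spine ⟨0, C.npos⟩, C.spineMem ⟨0, C.npos⟩⟩ x
  let vlast : ↥C.verts ⊕ Fin x :=
    Sum.inl ⟨C.spine ⟨C.n - 1, Nat.sub_lt C.npos Nat.one_pos⟩,
      C.spineMem ⟨C.n - 1, Nat.sub_lt C.npos Nat.one_pos⟩⟩
  if x ≤ d ∧ cocOptOn Cx Set.univ d = cocOptOn G C.verts d then
    sInf {b : ℕ | ∃ Y : Set (↥C.verts ⊕ Fin x),
      IsMinCocSetOn Cx Set.univ d Y ∧ b = compSizeOn Cx Set.univ Y vlast}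
  else d + 1

/-- The set of vertices of `A` adjacent (in `G`) to some vertex of `X`. -/
def nbrIn (G : SimpleGraph V) (A X : Set V) : Set V :=
  {v : V | v ∈ A ∧ ∃ m ∈ X, G.Adj v m}

/-- The chunk `X` imposes a (strictly positive) conflict on the subgraph of `G`
induced on the vertex set `A`. -/
def HasConflict (G : SimpleGraph V) (d : ℕ) (A X : Set V) : Prop :=
  cocOptOn G A d < (nbrIn G A X).ncard + cocOptOn G (A \ nbrIn G A X) d

/-- A chunk: a subset of the modulator `M` of size one or two. -/
def IsChunk (M X : Set V) : Prop := X ⊆ M ∧ 1 ≤ X.ncard ∧ X.ncard ≤ 2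

/-- The `i`-th graph (0-based) of the `α`-merged packing of the ordered packing `H`. -/
def mergedPiece {t : ℕ} (H : Fin t → Set V) (α i : ℕ) : Set V :=
  ⋃ (j : Fin t) (_ : i * α ≤ (j : ℕ) ∧ (j : ℕ) < i * α + α), H j

/-- `H` enumerates a solution-tight packing of `C` in left-to-right spine order. -/
def IsOrderedSTP (G : SimpleGraph V) (d : ℕ) (C : SubCaterpillar G) {t : ℕ}
    (H : Fin t → Set V) : Prop :=
  Function.Injective H ∧
  (∃ P : Finset (Set V), IsSTP G d C P ∧ (↑P : Set (Set V)) = Set.range H) ∧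
  ∀ k k' : Fin t, k < k' → ∀ v ∈ H k, ∀ w ∈ H k', C.pos v < C.pos w

/-- Composition of a list of functions: `compList [g₁, …, gₗ] = g₁ ∘ g₂ ∘ ⋯ ∘ gₗ`. -/
def compList (L : List (ℕ → ℕ)) : ℕ → ℕ := L.foldr (· ∘ ·) id

/-- `inc^d_i`: maps `i` to `i+1` and fixes all other inputs. -/
def incAt (i : ℕ) : ℕ → ℕ := fun x => if x = i then i + 1 else x

/-- `dec^d_i`: maps `i` to `i-1` and fixes all other inputs. -/
def decAt (i : ℕ) : ℕ → ℕ := fun x => if x = i then i - 1 else x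

/-- `inc^d`: maps every `x` with `1 ≤ x ≤ d` to `x+1` and fixes all other inputs. -/
def incUpTo (d : ℕ) : ℕ → ℕ := fun x => if 1 ≤ x ∧ x ≤ d then x + 1 else x

/-- `inc^d_{i,j}`: maps every `x` with `i ≤ x ≤ j` to `j` and fixes all other inputs. -/
def incIJ (i j : ℕ) : ℕ → ℕ := fun x => if i ≤ x ∧ x ≤ j then j else x

/-- `dec^d_{i,j}`: maps every `x` with `i ≤ x ≤ j` to `i` and fixes all other inputs. -/
def decIJ (i j : ℕ) : ℕ → ℕ := fun x => if i ≤ x ∧ x ≤ j then i else x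

/-- The basic functions relative to `d`. -/
def IsBasicFun (d : ℕ) (f : ℕ → ℕ) : Prop :=
  f = id ∨ (∃ i, 1 ≤ i ∧ i ≤ d ∧ f = decAt i) ∨ f = incUpTo d

/-- The advanced functions relative to `d`. -/
def IsAdvancedFun (d : ℕ) (f : ℕ → ℕ) : Prop :=
  (∃ i, 1 ≤ i ∧ i ≤ d ∧ f = incAt i) ∨
  (∃ i j, 1 ≤ i ∧ i < j ∧ j ≤ d + 1 ∧ f = incIJ i j) ∨
  (∃ i j, i < j ∧ j ≤ d ∧ f = decIJ i j)

/-- The number of fixed points of `f` on the domain `{0, …, d+1}`. -/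
def fixCount (d : ℕ) (f : ℕ → ℕ) : ℕ :=
  ((Finset.range (d + 2)).filter fun x => f x = x).card

/-- The disjoint union of `G₁` and `G₂` together with the edge `a b`. -/
def joinGraph {V₁ V₂ : Type} (G₁ : SimpleGraph V₁) (G₂ : SimpleGraph V₂)
    (a : V₁) (b : V₂) : SimpleGraph (V₁ ⊕ V₂) :=
  SimpleGraph.fromRel fun x y =>
    (∃ u w, x = Sum.inl u ∧ y = Sum.inl w ∧ G₁.Adj u w) ∨
    (∃ u w, x = Sum.inr u ∧ y = Sum.inr w ∧ G₂.Adj u w) ∨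
    (x = Sum.inl a ∧ y = Sum.inr b)


/-- The vertices reachable from `v` inside the vertex set `D` (empty if `v ∉ D`). -/
def compIn (G : SimpleGraph V) (D : Set V) (v : V) : Set V :=
  {w | v ∈ D ∧ Relation.ReflTransGen (fun a b => G.Adj a b ∧ b ∈ D) v w}

section compIn

variable {G : SimpleGraph V} {D : Set V} {u v w : V}

lemma mem_compIn_self (h : v ∈ D) : v ∈ compIn G D v := ⟨h, .refl⟩

lemma compIn_subset : compIn G D v ⊆ D := by
  rintro w ⟨hv, h⟩
  induction h with
  | refl => exact hv
  | tail _ h _ => exact h.2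

lemma compIn_eq_empty (h : v ∉ D) : compIn G D v = ∅ := by
  ext w
  simp [compIn, h]

lemma compIn_step (h : u ∈ compIn G D v) (ha : G.Adj u w) (hw : w ∈ D) : w ∈ compIn G D v :=
  ⟨h.1, h.2.tail ⟨ha, hw⟩⟩

lemma compIn_trans (h : u ∈ compIn G D v) (h' : w ∈ compIn G D u) : w ∈ compIn G D v :=
  ⟨h.1, h.2.trans h'.2⟩

lemma compIn_symm (h : w ∈ compIn G D v) : v ∈ compIn G D w := by
  obtain ⟨hv, h⟩ := h
  induction h with
  | refl => exact mem_compIn_self hv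
  | @tail b c hb hbc ih =>
    have hbD : b ∈ D := compIn_subset (v := v) (G := G) ⟨hv, hb⟩
    exact compIn_trans (compIn_step (mem_compIn_self hbc.2) hbc.1.symm hbD) ih

lemma mem_compIn_comm : w ∈ compIn G D v ↔ v ∈ compIn G D w := ⟨compIn_symm, compIn_symm⟩

lemma compIn_eq_of_mem (h : w ∈ compIn G D v) : compIn G D w = compIn G D v :=
  Set.Subset.antisymm (fun _ hx => compIn_trans h hx) fun _ hx => compIn_trans (compIn_symm h) hx

/-- A set which contains `v` and is closed under taking neighbours in `D` contains the component
of `v`. -/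
lemma compIn_subset_of_closed {K : Set V} (hv : v ∈ D → v ∈ K)
    (hK : ∀ a ∈ K, a ∈ D → ∀ b ∈ D, G.Adj a b → b ∈ K) : compIn G D v ⊆ K := by
  rintro w ⟨hvD, h⟩
  induction h with
  | refl => exact hv hvD
  | @tail b c hb hbc ih => exact hK b ih (compIn_subset (v := v) (G := G) ⟨hvD, hb⟩) c hbc.2 hbc.1

lemma compIn_map {G' : SimpleGraph W} {D' : Set W} (f : V → W)
    (hadj : ∀ a b, G.Adj a b → G'.Adj (f a) (f b)) (hD : ∀ a ∈ D, f a ∈ D')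
    (h : w ∈ compIn G D v) : f w ∈ compIn G' D' (f v) := by
  obtain ⟨hv, h⟩ := h
  induction h with
  | refl => exact mem_compIn_self (hD _ hv)
  | tail _ hbc ih => exact compIn_step ih (hadj _ _ hbc.1) (hD _ hbc.2)

lemma compIn_iso {G' : SimpleGraph W} (e : G ≃g G') (D : Set V) (v : V) :
    compIn G' (e '' D) (e v) = e '' compIn G D v := by
  apply Set.Subset.antisymm
  · intro w hw
    refine ⟨e.symm w, ?_, by simp⟩
    have := compIn_map (G' := G) (D' := D) e.symm (fun a b h => e.symm.map_adj_iff.2 h)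
      (by rintro _ ⟨a, ha, rfl⟩; simpa using ha) hw
    simpa using this
  · rintro _ ⟨w, hw, rfl⟩
    exact compIn_map e (fun a b h => e.map_adj_iff.2 h) (fun a ha => ⟨a, ha, rfl⟩) hw

lemma reachable_induce_iff (hv : v ∈ D) (hw : w ∈ D) :
    (G.induce D).Reachable ⟨v, hv⟩ ⟨w, hw⟩ ↔ w ∈ compIn G D v := by
  constructor
  · intro h
    rw [SimpleGraph.reachable_iff_reflTransGen] at h
    refine ⟨hv, ?_⟩
    exact h.lift (p := fun a b => G.Adj a b ∧ b ∈ D) Subtype.val fun a b hab => ⟨hab, b.2⟩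
  · rintro ⟨-, h⟩
    induction h with
    | refl => rfl
    | @tail b c hb hbc ih =>
      have hbD : b ∈ D := compIn_subset (v := v) (G := G) ⟨hv, hb⟩
      exact (ih hbD).trans (SimpleGraph.Adj.reachable (G := G.induce D) (by simpa using hbc.1))

lemma compSizeOn_eq (A S : Set V) : compSizeOn G A S v = (compIn G (A \ S) v).ncard := by
  unfold compSizeOn
  congr 1
  ext w
  constructor
  · rintro ⟨hv, hw, h⟩
    exact (reachable_induce_iff hv hw).1 h
  · intro h
    exact ⟨h.1, compIn_subset h, (reachable_induce_iff h.1 (compIn_subset h)).2 h⟩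

lemma isCocSetOn_iff {A S : Set V} {d : ℕ} :
    IsCocSetOn G A d S ↔ ∀ v, (compIn G (A \ S) v).ncard ≤ d := by
  have key : ∀ v (hv : v ∈ A \ S),
      ((G.induce (A \ S)).connectedComponentMk ⟨v, hv⟩).supp.ncard
        = (compIn G (A \ S) v).ncard := by
    intro v hv
    rw [← Set.ncard_image_of_injective _ Subtype.val_injective]
    congr 1
    ext w
    constructor
    · rintro ⟨⟨w, hw⟩, h, rfl⟩
      exact (reachable_induce_iff hv hw).1 (SimpleGraph.ConnectedComponent.exact h).symm
    · intro h
      exact ⟨⟨w, compIn_subset h⟩, SimpleGraph.ConnectedComponent.sound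
        ((reachable_induce_iff hv (compIn_subset h)).2 h).symm, rfl⟩
  constructor
  · intro h v
    by_cases hv : v ∈ A \ S
    · rw [← key v hv]
      exact h _
    · simp [compIn_eq_empty hv]
  · intro h c
    induction c using SimpleGraph.ConnectedComponent.ind with
    | _ v => rw [key v.1 v.2]; exact h _

end compIn

/-- `S` is a `d`-coc set of the whole graph `G`. -/
def IsCoc (G : SimpleGraph V) (d : ℕ) (S : Set V) : Prop :=
  ∀ v, (compIn G Sᶜ v).ncard ≤ d

lemma isCocSetOn_univ_iff {G : SimpleGraph V} {d : ℕ} {S : Set V} :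
    IsCocSetOn G Set.univ d S ↔ IsCoc G d S := by
  rw [isCocSetOn_iff, IsCoc, Set.compl_eq_univ_sdiff]

/-- The minimum size of a `d`-coc set of the whole graph `G`. -/
noncomputable abbrev cocOpt (G : SimpleGraph V) (d : ℕ) : ℕ := cocOptOn G Set.univ d

lemma cocOpt_le {G : SimpleGraph V} {d : ℕ} {S : Set V} (h : IsCoc G d S) :
    cocOpt G d ≤ S.ncard :=
  Nat.sInf_le ⟨S, Set.subset_univ _, isCocSetOn_univ_iff.2 h, rfl⟩

lemma exists_isCoc_ncard_eq (G : SimpleGraph V) (d : ℕ) :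
    ∃ S, IsCoc G d S ∧ S.ncard = cocOpt G d := by
  have : cocOpt G d ∈ {m : ℕ | ∃ S : Set V, S ⊆ Set.univ ∧ IsCocSetOn G Set.univ d S ∧
      S.ncard = m} := by
    refine Nat.sInf_mem ⟨_, Set.univ, subset_rfl, isCocSetOn_univ_iff.2 fun v => ?_, rfl⟩
    simp [compIn_eq_empty]
  obtain ⟨S, -, hS, h⟩ := this
  exact ⟨S, isCocSetOn_univ_iff.1 hS, h⟩

lemma isMinCocSetOn_univ_iff {G : SimpleGraph V} {d : ℕ} {S : Set V} :
    IsMinCocSetOn G Set.univ d S ↔ IsCoc G d S ∧ S.ncard = cocOpt G d := by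
  simp [IsMinCocSetOn, isCocSetOn_univ_iff]

open Classical in
/-- The size of the component of `l` in `G - Y`, where `v` carries `x` additional pendants. -/
noncomputable def weight (G : SimpleGraph V) (v l : V) (x : ℕ) (Y : Set V) : ℕ :=
  (compIn G Yᶜ l).ncard + if v ∈ compIn G Yᶜ l then x else 0

/-- `Y` has the optimum size of a coc set of `G`, and is a coc set of `G` even when `x` pendants
are attached to `v`. -/
def Tolerates (G : SimpleGraph V) (v : V) (d x : ℕ) (Y : Set V) : Prop :=
  Y.ncard = cocOpt G d ∧ ∀ u, weight G v u x Y ≤ d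

open Classical in
/-- The essence, expressed through the graph without pendants. -/
noncomputable def graphEssence (G : SimpleGraph V) (v l : V) (d x : ℕ) : ℕ :=
  if x ≤ d ∧ ∃ Y, Tolerates G v d x Y then
    sInf {k | ∃ Y, Tolerates G v d x Y ∧ k = weight G v l x Y} else d + 1

lemma compl_image_iso {G : SimpleGraph V} {G' : SimpleGraph W} (e : G ≃g G') (Y : Set V) :
    (e '' Y)ᶜ = e '' Yᶜ := (Set.image_compl_eq e.bijective).symm

lemma weight_iso {G : SimpleGraph V} {G' : SimpleGraph W} (e : G ≃g G') (v l : V) (x : ℕ)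
    (Y : Set V) : weight G' (e v) (e l) x (e '' Y) = weight G v l x Y := by
  unfold weight
  rw [compl_image_iso, compIn_iso, Set.ncard_image_of_injective _ e.injective,
    e.injective.mem_set_image]

lemma isCoc_iso {G : SimpleGraph V} {G' : SimpleGraph W} (e : G ≃g G') {d : ℕ} {Y : Set V} :
    IsCoc G' d (e '' Y) ↔ IsCoc G d Y := by
  unfold IsCoc
  rw [e.surjective.forall]
  simp only [compl_image_iso, compIn_iso, Set.ncard_image_of_injective _ e.injective]

lemma cocOpt_le_of_iso {G : SimpleGraph V} {G' : SimpleGraph W} (e : G ≃g G') (d : ℕ) :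
    cocOpt G' d ≤ cocOpt G d := by
  obtain ⟨S, hS, h⟩ := exists_isCoc_ncard_eq G d
  rw [← h, ← Set.ncard_image_of_injective S e.injective]
  exact cocOpt_le ((isCoc_iso e).2 hS)

lemma cocOpt_iso {G : SimpleGraph V} {G' : SimpleGraph W} (e : G ≃g G') (d : ℕ) :
    cocOpt G' d = cocOpt G d :=
  le_antisymm (cocOpt_le_of_iso e d) (cocOpt_le_of_iso e.symm d)

lemma tolerates_iso {G : SimpleGraph V} {G' : SimpleGraph W} (e : G ≃g G') {v : V} {d x : ℕ}
    {Y : Set V} : Tolerates G' (e v) d x (e '' Y) ↔ Tolerates G v d x Y := by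
  unfold Tolerates
  rw [cocOpt_iso e, Set.ncard_image_of_injective _ e.injective, e.surjective.forall]
  simp only [weight_iso]

lemma graphEssence_iso {G : SimpleGraph V} {G' : SimpleGraph W} (e : G ≃g G') (v l : V)
    (d x : ℕ) : graphEssence G' (e v) (e l) d x = graphEssence G v l d x := by
  have hsurj : Function.Surjective (fun Y : Set V => e '' Y) :=
    Set.image_surjective.2 e.surjective
  have hex : (∃ Y, Tolerates G' (e v) d x Y) ↔ ∃ Y, Tolerates G v d x Y := by
    rw [hsurj.exists]
    simp only [tolerates_iso]
  have hset : {k | ∃ Y, Tolerates G' (e v) d x Y ∧ k = weight G' (e v) (e l) x Y} =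
      {k | ∃ Y, Tolerates G v d x Y ∧ k = weight G v l x Y} := by
    ext k
    rw [Set.mem_ofPred_eq, hsurj.exists]
    simp only [tolerates_iso, weight_iso, Set.mem_ofPred_eq]
  rw [graphEssence, graphEssence, hset]
  classical
  exact if_congr (and_congr_right fun _ => hex) rfl rfl

section attach

variable {H : SimpleGraph W} {v : W} {x d : ℕ}

lemma attachPendants_adj_inl {a b : W} :
    (attachPendants H v x).Adj (.inl a) (.inl b) ↔ H.Adj a b := by
  simp only [attachPendants, SimpleGraph.fromRel_adj]
  constructor
  · rintro ⟨-, h | h⟩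
    · simpa using h
    · simpa using (show H.Adj b a by simpa using h).symm
  · intro h
    exact ⟨by simpa using h.ne, by simp [h]⟩

lemma attachPendants_adj_inr {a : W} {i : Fin x} :
    (attachPendants H v x).Adj (.inl a) (.inr i) ↔ a = v := by
  simp [attachPendants, SimpleGraph.fromRel_adj]

lemma attachPendants_not_adj_inr {i j : Fin x} :
    ¬ (attachPendants H v x).Adj (.inr i) (.inr j) := by
  simp [attachPendants, SimpleGraph.fromRel_adj]

lemma mem_compIn_attach_inl {Y : Set W} {u w : W} :
    Sum.inl w ∈ compIn (attachPendants H v x) (Sum.inl '' Y)ᶜ (.inl u) ↔ w ∈ compIn H Yᶜ u := by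
  constructor
  · intro h
    have : compIn (attachPendants H v x) (Sum.inl '' Y)ᶜ (.inl u) ⊆
        {z | ∀ w, z = .inl w ∨ (z.isRight ∧ w = v) → w ∈ compIn H Yᶜ u} := by
      apply compIn_subset_of_closed
      · intro hu w hw
        obtain rfl : u = w := by simpa using hw
        exact mem_compIn_self (by simpa using hu)
      · rintro (a | i) ha haD (b | j) hbD hab w hw
        · obtain rfl : b = w := by simpa using hw
          exact compIn_step (ha a (.inl rfl)) (attachPendants_adj_inl.1 hab) (by simpa using hbD)
        · obtain rfl := attachPendants_adj_inr.1 hab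
          obtain rfl : w = a := by simpa using hw
          exact ha _ (.inl rfl)
        · obtain rfl : b = w := by simpa using hw
          obtain rfl := attachPendants_adj_inr.1 hab.symm
          exact ha _ (.inr ⟨rfl, rfl⟩)
        · exact (attachPendants_not_adj_inr hab).elim
    exact this h w (.inl rfl)
  · exact compIn_map Sum.inl (fun a b h => attachPendants_adj_inl.2 h) (by simp)

lemma mem_compIn_attach_inr {Y : Set W} {u : W} {i : Fin x} :
    Sum.inr i ∈ compIn (attachPendants H v x) (Sum.inl '' Y)ᶜ (.inl u) ↔
      v ∈ compIn H Yᶜ u := by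
  rw [← mem_compIn_attach_inl (x := x) (v := v)]
  constructor
  · rintro ⟨hu, h⟩
    obtain h | ⟨b, hb, hbi, -⟩ := h.cases_tail
    · simp at h
    · rcases b with b | j
      · obtain rfl := attachPendants_adj_inr.1 hbi
        exact ⟨hu, hb⟩
      · exact (attachPendants_not_adj_inr hbi).elim
  · intro h
    exact compIn_step h (attachPendants_adj_inr.2 rfl) (by simp)

lemma ncard_compIn_attach [Finite W] (Y : Set W) (u : W) :
    (compIn (attachPendants H v x) (Sum.inl '' Y)ᶜ (.inl u)).ncard = weight H v u x Y := by
  classical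
  have h : compIn (attachPendants H v x) (Sum.inl '' Y)ᶜ (.inl u) =
      Sum.inl '' compIn H Yᶜ u ∪ Sum.inr '' {_i : Fin x | v ∈ compIn H Yᶜ u} := by
    ext (w | i)
    · simp [mem_compIn_attach_inl]
    · simp [mem_compIn_attach_inr]
  rw [h, Set.ncard_union_eq, Set.ncard_image_of_injective _ Sum.inl_injective,
    Set.ncard_image_of_injective _ Sum.inr_injective, weight]
  · split_ifs with hv <;> simp [hv]
  · rw [Set.disjoint_left]
    rintro _ ⟨a, -, rfl⟩ ⟨b, -, h⟩
    simp at h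

lemma weight_le_of_isCoc_attach [Finite W] {Y : Set W}
    (h : IsCoc (attachPendants H v x) d (Sum.inl '' Y)) (u : W) : weight H v u x Y ≤ d := by
  rw [← ncard_compIn_attach]
  exact h _

lemma isCoc_attach [Finite W] (hd : 1 ≤ d) {Y : Set W} (h : ∀ u, weight H v u x Y ≤ d) :
    IsCoc (attachPendants H v x) d (Sum.inl '' Y) := by
  rintro (u | i)
  · rw [ncard_compIn_attach]
    exact h u
  · by_cases hv : v ∈ Y
    · refine (Set.ncard_le_ncard (t := {Sum.inr i}) ?_).trans (by simpa using hd)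
      apply compIn_subset_of_closed (by simp)
      rintro _ rfl - (b | j) hb hab
      · obtain rfl := attachPendants_adj_inr.1 hab.symm
        exact (hb ⟨_, hv, rfl⟩).elim
      · exact (attachPendants_not_adj_inr hab).elim
    · have : Sum.inl v ∈ compIn (attachPendants H v x) (Sum.inl '' Y)ᶜ (.inr i) :=
        compIn_step (mem_compIn_self (by simp)) (attachPendants_adj_inr.2 rfl).symm (by simpa)
      rw [← compIn_eq_of_mem this, ncard_compIn_attach]
      exact h v

lemma isCoc_of_attach [Finite W] {Y : Set (W ⊕ Fin x)} (h : IsCoc (attachPendants H v x) d Y) :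
    IsCoc H d (Sum.inl ⁻¹' Y) := by
  intro u
  refine le_trans ?_ (h (.inl u))
  rw [← Set.ncard_image_of_injective _ (Sum.inl_injective (β := Fin x))]
  refine Set.ncard_le_ncard ?_ (Set.toFinite _)
  rintro _ ⟨w, hw, rfl⟩
  exact compIn_map Sum.inl (fun a b h => attachPendants_adj_inl.2 h) (by simp) hw

lemma ncard_preimage_inl_le [Finite W] {Y : Set (W ⊕ Fin x)} :
    (Sum.inl ⁻¹' Y).ncard ≤ Y.ncard := by
  rw [← Set.ncard_image_of_injective _ (Sum.inl_injective (β := Fin x))]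
  exact Set.ncard_le_ncard (Set.image_preimage_subset _ _)

lemma isMinCoc_attach_iff [Finite W] (hd : 1 ≤ d) {Y : Set (W ⊕ Fin x)} :
    IsCoc (attachPendants H v x) d Y ∧ Y.ncard = cocOpt H d ↔
      ∃ Z, Tolerates H v d x Z ∧ Y = Sum.inl '' Z := by
  constructor
  · rintro ⟨hY, hc⟩
    have h1 := cocOpt_le (isCoc_of_attach hY)
    have hYeq : Sum.inl '' (Sum.inl ⁻¹' Y) = Y := by
      apply Set.eq_of_subset_of_ncard_le (Set.image_preimage_subset _ _)
      rwa [Set.ncard_image_of_injective _ Sum.inl_injective, hc]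
    refine ⟨Sum.inl ⁻¹' Y, ⟨le_antisymm (hc ▸ ncard_preimage_inl_le) h1, ?_⟩,
      hYeq.symm⟩
    apply weight_le_of_isCoc_attach
    rwa [hYeq]
  · rintro ⟨Z, ⟨hZ, hw⟩, rfl⟩
    exact ⟨isCoc_attach hd hw, by rwa [Set.ncard_image_of_injective _ Sum.inl_injective]⟩

lemma cocOpt_attach_eq_iff [Finite W] (hd : 1 ≤ d) :
    cocOpt (attachPendants H v x) d = cocOpt H d ↔ ∃ Z, Tolerates H v d x Z := by
  constructor
  · intro h
    obtain ⟨Y, hY, hc⟩ := exists_isCoc_ncard_eq (attachPendants H v x) d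
    obtain ⟨Z, hZ, -⟩ := (isMinCoc_attach_iff hd).1 ⟨hY, hc.trans h⟩
    exact ⟨Z, hZ⟩
  · rintro ⟨Z, hZ⟩
    obtain ⟨h1, h2⟩ := (isMinCoc_attach_iff hd).2 ⟨Z, hZ, rfl⟩
    obtain ⟨Y, hY, hc⟩ := exists_isCoc_ncard_eq (attachPendants H v x) d
    refine le_antisymm (h2 ▸ cocOpt_le h1) ?_
    rw [← hc]
    exact (cocOpt_le (isCoc_of_attach hY)).trans ncard_preimage_inl_le

end attach

lemma SubCaterpillar.essence_eq_graphEssence [Finite V] {G : SimpleGraph V}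
    (C : SubCaterpillar G) (hC : C.verts = Set.univ) {d : ℕ} (hd : 1 ≤ d) (x : ℕ) :
    C.essence d x = graphEssence G (C.spine ⟨0, C.npos⟩)
      (C.spine ⟨C.n - 1, Nat.sub_lt C.npos Nat.one_pos⟩) d x := by
  let e : G.induce C.verts ≃g G :=
    ⟨⟨Subtype.val, fun v => ⟨v, hC ▸ Set.mem_univ v⟩, fun _ => rfl, fun _ => rfl⟩, Iff.rfl⟩
  have hopt : cocOptOn G C.verts d = cocOpt (G.induce C.verts) d := by
    rw [← cocOpt_iso e d, cocOpt, hC]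
  rw [show C.spine ⟨0, C.npos⟩ = e ⟨_, C.spineMem _⟩ from rfl,
    show C.spine ⟨C.n - 1, Nat.sub_lt C.npos Nat.one_pos⟩ = e ⟨_, C.spineMem _⟩ from rfl,
    graphEssence_iso]
  classical
  refine if_ctx_congr (by rw [hopt, cocOpt_attach_eq_iff hd]) (fun h => ?_) fun _ => rfl
  · congr 1
    ext k
    constructor
    · rintro ⟨Y, hY, rfl⟩
      rw [isMinCocSetOn_univ_iff, (cocOpt_attach_eq_iff hd).2 h.2, isMinCoc_attach_iff hd] at hY
      obtain ⟨Z, hZ, rfl⟩ := hY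
      refine ⟨Z, hZ, ?_⟩
      rw [compSizeOn_eq, ← Set.compl_eq_univ_sdiff, ncard_compIn_attach]
    · rintro ⟨Z, hZ, rfl⟩
      refine ⟨Sum.inl '' Z, ?_, ?_⟩
      · rw [isMinCocSetOn_univ_iff, (cocOpt_attach_eq_iff hd).2 h.2, isMinCoc_attach_iff hd]
        exact ⟨Z, hZ, rfl⟩
      · rw [compSizeOn_eq, ← Set.compl_eq_univ_sdiff, ncard_compIn_attach]

section weight

variable {G : SimpleGraph V} {v u l : V} {x y d : ℕ} {Y : Set V}

lemma ncard_compIn_le_weight : (compIn G Yᶜ u).ncard ≤ weight G v u x Y :=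
  Nat.le_add_right _ _

lemma weight_mono (h : x ≤ y) : weight G v u x Y ≤ weight G v u y Y := by
  unfold weight
  split_ifs <;> omega

lemma Tolerates.mono (h : Tolerates G v d y Y) (hxy : x ≤ y) : Tolerates G v d x Y :=
  ⟨h.1, fun u => (weight_mono hxy).trans (h.2 u)⟩

lemma Tolerates.isCoc (h : Tolerates G v d x Y) : IsCoc G d Y :=
  fun u => ncard_compIn_le_weight.trans (h.2 u)

lemma graphEssence_of_exists (hx : x ≤ d) (h : ∃ Y, Tolerates G v d x Y) :
    graphEssence G v l d x = sInf {k | ∃ Y, Tolerates G v d x Y ∧ k = weight G v l x Y} :=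
  if_pos ⟨hx, h⟩

lemma graphEssence_of_not (h : ¬ (x ≤ d ∧ ∃ Y, Tolerates G v d x Y)) :
    graphEssence G v l d x = d + 1 :=
  if_neg h

lemma exists_weight_eq_graphEssence (hx : x ≤ d) (h : ∃ Y, Tolerates G v d x Y) :
    ∃ Y, Tolerates G v d x Y ∧ graphEssence G v l d x = weight G v l x Y := by
  rw [graphEssence_of_exists hx h]
  obtain ⟨Y, hY⟩ := h
  exact Nat.sInf_mem (s := {k | ∃ Y, Tolerates G v d x Y ∧ k = weight G v l x Y}) ⟨_, Y, hY, rfl⟩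

lemma graphEssence_le_weight (hx : x ≤ d) (h : Tolerates G v d x Y) :
    graphEssence G v l d x ≤ weight G v l x Y := by
  rw [graphEssence_of_exists hx ⟨Y, h⟩]
  exact Nat.sInf_le ⟨Y, h, rfl⟩

end weight

section join

variable {V₁ V₂ : Type} {G₁ : SimpleGraph V₁} {G₂ : SimpleGraph V₂} {a : V₁} {b : V₂}

lemma joinGraph_adj_inl {u w : V₁} :
    (joinGraph G₁ G₂ a b).Adj (.inl u) (.inl w) ↔ G₁.Adj u w := by
  simp only [joinGraph, SimpleGraph.fromRel_adj]
  constructor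
  · rintro ⟨-, h | h⟩
    · simpa using h
    · simpa using (show G₁.Adj w u by simpa using h).symm
  · intro h
    exact ⟨by simpa using h.ne, by simp [h]⟩

lemma joinGraph_adj_inr {u w : V₂} :
    (joinGraph G₁ G₂ a b).Adj (.inr u) (.inr w) ↔ G₂.Adj u w := by
  simp only [joinGraph, SimpleGraph.fromRel_adj]
  constructor
  · rintro ⟨-, h | h⟩
    · simpa using h
    · simpa using (show G₂.Adj w u by simpa using h).symm
  · intro h
    exact ⟨by simpa using h.ne, by simp [h]⟩

lemma joinGraph_adj_inl_inr {u : V₁} {w : V₂} :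
    (joinGraph G₁ G₂ a b).Adj (.inl u) (.inr w) ↔ u = a ∧ w = b := by
  simp [joinGraph, SimpleGraph.fromRel_adj]

/-- The join graph is symmetric in its two parts. -/
def joinGraphComm (G₁ : SimpleGraph V₁) (G₂ : SimpleGraph V₂) (a : V₁) (b : V₂) :
    joinGraph G₁ G₂ a b ≃g joinGraph G₂ G₁ b a where
  toEquiv := Equiv.sumComm V₁ V₂
  map_rel_iff' := by
    rintro (u | u) (w | w)
    · simp [joinGraph_adj_inl, joinGraph_adj_inr]
    · simp [SimpleGraph.adj_comm _ (Sum.inr u), joinGraph_adj_inl_inr, and_comm]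
    · simp [SimpleGraph.adj_comm _ (Sum.inr u), joinGraph_adj_inl_inr, and_comm]
    · simp [joinGraph_adj_inl, joinGraph_adj_inr]

lemma compIn_join_inl (D : Set (V₁ ⊕ V₂)) (u : V₁) :
    compIn (joinGraph G₁ G₂ a b) D (.inl u) =
      Sum.inl '' compIn G₁ (Sum.inl ⁻¹' D) u ∪
        Sum.inr '' {w | a ∈ compIn G₁ (Sum.inl ⁻¹' D) u ∧ w ∈ compIn G₂ (Sum.inr ⁻¹' D) b} := by
  have hl : ∀ {u w}, w ∈ compIn G₁ (Sum.inl ⁻¹' D) u →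
      Sum.inl w ∈ compIn (joinGraph G₁ G₂ a b) D (.inl u) :=
    compIn_map Sum.inl (fun _ _ h => joinGraph_adj_inl.2 h) (fun _ h => h)
  have hr : ∀ {u w}, w ∈ compIn G₂ (Sum.inr ⁻¹' D) u →
      Sum.inr w ∈ compIn (joinGraph G₁ G₂ a b) D (.inr u) :=
    compIn_map Sum.inr (fun _ _ h => joinGraph_adj_inr.2 h) (fun _ h => h)
  apply Set.Subset.antisymm
  · apply compIn_subset_of_closed
    · exact fun hu => .inl ⟨u, mem_compIn_self hu, rfl⟩
    · rintro _ (⟨p, hp, rfl⟩ | ⟨p, ⟨ha, hp⟩, rfl⟩) hpD (q | q) hqD hpq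
      · exact .inl ⟨q, compIn_step hp (joinGraph_adj_inl.1 hpq) hqD, rfl⟩
      · obtain ⟨rfl, rfl⟩ := joinGraph_adj_inl_inr.1 hpq
        exact .inr ⟨q, ⟨hp, mem_compIn_self hqD⟩, rfl⟩
      · obtain ⟨rfl, rfl⟩ := joinGraph_adj_inl_inr.1 hpq.symm
        exact .inl ⟨q, ha, rfl⟩
      · exact .inr ⟨q, ⟨ha, compIn_step hp (joinGraph_adj_inr.1 hpq) hqD⟩, rfl⟩
  · rintro _ (⟨w, hw, rfl⟩ | ⟨w, ⟨ha, hw⟩, rfl⟩)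
    · exact hl hw
    · exact compIn_trans (compIn_step (hl ha) (joinGraph_adj_inl_inr.2 ⟨rfl, rfl⟩) hw.1) (hr hw)

lemma mem_compIn_join_inl {D : Set (V₁ ⊕ V₂)} {u w : V₁} :
    Sum.inl w ∈ compIn (joinGraph G₁ G₂ a b) D (.inl u) ↔
      w ∈ compIn G₁ (Sum.inl ⁻¹' D) u := by
  simp [compIn_join_inl]

lemma mem_compIn_join_inl_inr {D : Set (V₁ ⊕ V₂)} {u : V₁} {w : V₂} :
    Sum.inr w ∈ compIn (joinGraph G₁ G₂ a b) D (.inl u) ↔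
      a ∈ compIn G₁ (Sum.inl ⁻¹' D) u ∧ w ∈ compIn G₂ (Sum.inr ⁻¹' D) b := by
  simp [compIn_join_inl]

lemma preimages_image_union (Z₁ : Set V₁) (Z₂ : Set V₂) :
    Sum.inl ⁻¹' (Sum.inl '' Z₁ ∪ Sum.inr '' Z₂) = Z₁ ∧
      Sum.inr ⁻¹' (Sum.inl '' Z₁ ∪ Sum.inr '' Z₂) = Z₂ := by
  constructor <;> ext <;> simp

variable [Finite V₁] [Finite V₂]

lemma ncard_compIn_join_inl (Y : Set (V₁ ⊕ V₂)) (u : V₁) :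
    (compIn (joinGraph G₁ G₂ a b) Yᶜ (.inl u)).ncard =
      weight G₁ a u (compIn G₂ (Sum.inr ⁻¹' Y)ᶜ b).ncard (Sum.inl ⁻¹' Y) := by
  rw [compIn_join_inl, Set.ncard_union_eq, Set.ncard_image_of_injective _ Sum.inl_injective,
    Set.ncard_image_of_injective _ Sum.inr_injective, weight]
  · simp only [Set.preimage_compl]
    split_ifs with h <;> simp [h]
  · rw [Set.disjoint_left]
    rintro _ ⟨p, -, rfl⟩ ⟨q, -, h⟩
    simp at h

lemma ncard_compIn_join_inr (Y : Set (V₁ ⊕ V₂)) (u : V₂) :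
    (compIn (joinGraph G₁ G₂ a b) Yᶜ (.inr u)).ncard =
      weight G₂ b u (compIn G₁ (Sum.inl ⁻¹' Y)ᶜ a).ncard (Sum.inr ⁻¹' Y) := by
  let e := joinGraphComm G₁ G₂ a b
  have hl : Sum.inl ⁻¹' (e '' Y) = Sum.inr ⁻¹' Y := by
    ext w
    exact e.injective.mem_set_image (a := Sum.inr w)
  have hr : Sum.inr ⁻¹' (e '' Y) = Sum.inl ⁻¹' Y := by
    ext w
    exact e.injective.mem_set_image (a := Sum.inl w)
  rw [← Set.ncard_image_of_injective _ e.injective, ← compIn_iso, ← compl_image_iso,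
    ← hl, ← hr, ← ncard_compIn_join_inl]
  rfl

open Classical in
lemma weight_join_inl (v u : V₁) (x : ℕ) (Y : Set (V₁ ⊕ V₂)) :
    weight (joinGraph G₁ G₂ a b) (.inl v) (.inl u) x Y =
      weight G₁ a u (compIn G₂ (Sum.inr ⁻¹' Y)ᶜ b).ncard (Sum.inl ⁻¹' Y) +
        if v ∈ compIn G₁ (Sum.inl ⁻¹' Y)ᶜ u then x else 0 := by
  rw [weight, ncard_compIn_join_inl]
  simp only [mem_compIn_join_inl, Set.preimage_compl]

lemma weight_join_inr (v : V₁) (l : V₂) (x : ℕ) (Y : Set (V₁ ⊕ V₂)) :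
    weight (joinGraph G₁ G₂ a b) (.inl v) (.inr l) x Y =
      weight G₂ b l (weight G₁ v a x (Sum.inl ⁻¹' Y)) (Sum.inr ⁻¹' Y) := by
  have h : Sum.inl v ∈ compIn (joinGraph G₁ G₂ a b) Yᶜ (.inr l) ↔
      v ∈ compIn G₁ (Sum.inl ⁻¹' Y)ᶜ a ∧ b ∈ compIn G₂ (Sum.inr ⁻¹' Y)ᶜ l := by
    rw [mem_compIn_comm, mem_compIn_join_inl_inr, mem_compIn_comm, mem_compIn_comm (v := b)]
    rfl
  rw [weight, ncard_compIn_join_inr]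
  simp only [weight, h]
  split_ifs <;> (simp_all; try omega)

lemma ncard_eq_add_preimages (Y : Set (V₁ ⊕ V₂)) :
    Y.ncard = (Sum.inl ⁻¹' Y).ncard + (Sum.inr ⁻¹' Y).ncard := by
  conv_lhs => rw [← Set.image_preimage_inl_union_image_preimage_inr Y]
  rw [Set.ncard_union_eq, Set.ncard_image_of_injective _ Sum.inl_injective,
    Set.ncard_image_of_injective _ Sum.inr_injective]
  rw [Set.disjoint_left]
  rintro _ ⟨p, -, rfl⟩ ⟨q, -, h⟩
  simp at h

lemma isCoc_of_join {d : ℕ} {Y : Set (V₁ ⊕ V₂)} (h : IsCoc (joinGraph G₁ G₂ a b) d Y) :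
    IsCoc G₁ d (Sum.inl ⁻¹' Y) ∧ IsCoc G₂ d (Sum.inr ⁻¹' Y) := by
  constructor
  · intro u
    exact ncard_compIn_le_weight.trans ((ncard_compIn_join_inl Y u).symm.trans_le (h _))
  · intro u
    exact ncard_compIn_le_weight.trans ((ncard_compIn_join_inr Y u).symm.trans_le (h _))

lemma cocOpt_join {d : ℕ} (h : ∃ Z, IsCoc G₁ d Z ∧ Z.ncard = cocOpt G₁ d ∧ a ∈ Z) :
    cocOpt (joinGraph G₁ G₂ a b) d = cocOpt G₁ d + cocOpt G₂ d := by
  apply le_antisymm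
  · obtain ⟨Z₁, h₁, hc₁, ha⟩ := h
    obtain ⟨Z₂, h₂, hc₂⟩ := exists_isCoc_ncard_eq G₂ d
    obtain ⟨hl, hr⟩ := preimages_image_union Z₁ Z₂
    have hcard := ncard_eq_add_preimages (Sum.inl '' Z₁ ∪ Sum.inr '' Z₂)
    rw [hl, hr, hc₁, hc₂] at hcard
    rw [← hcard]
    apply cocOpt_le
    have ha' : ∀ u, a ∉ compIn G₁ Z₁ᶜ u := fun u h => compIn_subset h ha
    rintro (u | u)
    · rw [ncard_compIn_join_inl, hl, weight, if_neg (ha' u)]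
      exact h₁ u
    · rw [ncard_compIn_join_inr, hl, hr, compIn_eq_empty (by simpa using ha)]
      simpa [weight] using h₂ u
  · obtain ⟨Z, hZ, hc⟩ := exists_isCoc_ncard_eq (joinGraph G₁ G₂ a b) d
    rw [← hc, ncard_eq_add_preimages]
    exact add_le_add (cocOpt_le (isCoc_of_join hZ).1) (cocOpt_le (isCoc_of_join hZ).2)

lemma tolerates_join_iff {d x : ℕ} {v : V₁} {Y : Set (V₁ ⊕ V₂)}
    (hopt : cocOpt (joinGraph G₁ G₂ a b) d = cocOpt G₁ d + cocOpt G₂ d) :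
    Tolerates (joinGraph G₁ G₂ a b) (.inl v) d x Y ↔
      Tolerates G₁ v d x (Sum.inl ⁻¹' Y) ∧
        Tolerates G₂ b d (weight G₁ v a x (Sum.inl ⁻¹' Y)) (Sum.inr ⁻¹' Y) := by
  classical
  constructor
  · intro h
    obtain ⟨h₁, h₂⟩ := isCoc_of_join h.isCoc
    have hc := h.1
    rw [hopt, ncard_eq_add_preimages] at hc
    have hc₁ := cocOpt_le h₁
    have hc₂ := cocOpt_le h₂
    refine ⟨⟨by omega, fun u => ?_⟩, by omega, fun u => ?_⟩
    · refine le_trans ?_ (h.2 (.inl u))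
      rw [weight_join_inl]
      exact Nat.add_le_add ncard_compIn_le_weight (by congr!)
    · rw [← weight_join_inr]
      exact h.2 _
  · rintro ⟨h₁, h₂⟩
    refine ⟨by rw [hopt, ncard_eq_add_preimages, h₁.1, h₂.1], ?_⟩
    rintro (u | u)
    · by_cases ha : a ∈ compIn G₁ (Sum.inl ⁻¹' Y)ᶜ u
      · have hw : weight (joinGraph G₁ G₂ a b) (.inl v) (.inl u) x Y =
            (compIn G₂ (Sum.inr ⁻¹' Y)ᶜ b).ncard + weight G₁ v a x (Sum.inl ⁻¹' Y) := by
          rw [weight_join_inl, ← compIn_eq_of_mem ha]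
          simp only [weight, compIn_eq_of_mem ha, if_pos ha]
          omega
        rw [hw]
        by_cases hb : b ∈ (Sum.inr ⁻¹' Y)ᶜ
        · simpa [weight, mem_compIn_self hb] using h₂.2 b
        · simpa [compIn_eq_empty hb] using h₁.2 a
      · rw [weight_join_inl, weight, if_neg ha]
        exact h₁.2 u
    · rw [weight_join_inr]
      exact h₂.2 u

theorem graphEssence_join {d : ℕ} (h : ∃ Z, IsCoc G₁ d Z ∧ Z.ncard = cocOpt G₁ d ∧ a ∈ Z)
    (v : V₁) (l : V₂) (x : ℕ) :
    graphEssence (joinGraph G₁ G₂ a b) (.inl v) (.inr l) d x =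
      graphEssence G₂ b l d (graphEssence G₁ v a d x) := by
  have key (Y : Set (V₁ ⊕ V₂)) := tolerates_join_iff (v := v) (x := x) (Y := Y)
    (cocOpt_join (G₂ := G₂) (b := b) h)
  by_cases h₁ : x ≤ d ∧ ∃ Y, Tolerates G₁ v d x Y
  swap
  · rw [graphEssence_of_not h₁, graphEssence_of_not (x := d + 1) (by simp), graphEssence_of_not]
    rintro ⟨hx, Y, hY⟩
    exact h₁ ⟨hx, _, ((key Y).1 hY).1⟩
  obtain ⟨hx, h₁⟩ := h₁
  obtain ⟨Y₁, hY₁, hw⟩ := exists_weight_eq_graphEssence (l := a) hx h₁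
  have hle : graphEssence G₁ v a d x ≤ d := hw ▸ hY₁.2 a
  have hmin {Y} (hY : Tolerates (joinGraph G₁ G₂ a b) (.inl v) d x Y) :=
    graphEssence_le_weight (l := a) hx ((key Y).1 hY).1
  by_cases h₂ : ∃ Y, Tolerates G₂ b d (graphEssence G₁ v a d x) Y
  swap
  · rw [graphEssence_of_not (fun h => h₂ h.2), graphEssence_of_not]
    rintro ⟨-, Y, hY⟩
    exact h₂ ⟨_, ((key Y).1 hY).2.mono (hmin hY)⟩
  obtain ⟨Y₂, hY₂, hw₂⟩ := exists_weight_eq_graphEssence (l := l) hle h₂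
  obtain ⟨hl, hr⟩ := preimages_image_union Y₁ Y₂
  have hY : Tolerates (joinGraph G₁ G₂ a b) (.inl v) d x (Sum.inl '' Y₁ ∪ Sum.inr '' Y₂) := by
    rw [key, hl, hr, ← hw]
    exact ⟨hY₁, hY₂⟩
  apply le_antisymm
  · refine (graphEssence_le_weight hx hY).trans_eq ?_
    rw [weight_join_inr, hl, hr, ← hw, hw₂]
  · obtain ⟨Y, hY, hwY⟩ := exists_weight_eq_graphEssence (l := Sum.inr l) hx ⟨_, hY⟩
    rw [hwY, weight_join_inr]
    exact (graphEssence_le_weight hle (((key Y).1 hY).2.mono (hmin hY))).trans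
      (weight_mono (hmin hY))

end join

section packing

variable {G : SimpleGraph V} {C : SubCaterpillar G} {d : ℕ}

lemma SubCaterpillar.isTree_of_verts_eq_univ (C : SubCaterpillar G) (hC : C.verts = Set.univ) :
    G.IsTree := by
  have h := C.isTree
  rw [hC] at h
  exact (SimpleGraph.induceUnivIso G).isTree_iff.1 h

/-- Deleting an edge which is not on the spine between positions `i` and `k` leaves these
positions connected. -/
lemma SubCaterpillar.reachable_spine (C : SubCaterpillar G) (e : Sym2 V) {i k : ℕ} (hik : i ≤ k)
    (hk : k < C.n)
    (he : ∀ l (hl : l + 1 < C.n), i ≤ l → l < k →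
      s(C.spine ⟨l, by omega⟩, C.spine ⟨l + 1, hl⟩) ≠ e) :
    (G.deleteEdges {e}).Reachable (C.spine ⟨i, by omega⟩) (C.spine ⟨k, hk⟩) := by
  induction k, hik using Nat.le_induction with
  | base => rfl
  | succ k hik ih =>
    refine (ih (by omega) fun l hl h1 h2 => he l hl h1 (by omega)).trans
      (SimpleGraph.Adj.reachable ?_)
    rw [SimpleGraph.deleteEdges_adj]
    exact ⟨C.spineAdj k hk, he k hk hik (by omega)⟩

/-- If a connected set `A` contains a spine vertex but not a later spine vertex adjacent to it,
then no later spine vertex belongs to `A`. -/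
lemma SubCaterpillar.le_of_mem_of_adj_notMem (hC : C.verts = Set.univ) {A : Set V}
    (hA : (G.induce A).Connected) {i j k : Fin C.n} (hij : i < j) (hi : C.spine i ∈ A)
    (hj : C.spine j ∉ A) (hadj : G.Adj (C.spine i) (C.spine j)) (hk : C.spine k ∈ A) : k ≤ i := by
  have hbridge := SimpleGraph.isBridge_iff.1 (SimpleGraph.isAcyclic_iff_forall_adj_isBridge.1
    (C.isTree_of_verts_eq_univ hC).isAcyclic hadj)
  have hne : ∀ l (hl : l + 1 < C.n), (l ≠ i ∨ l + 1 ≠ j) →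
      s(C.spine ⟨l, by omega⟩, C.spine ⟨l + 1, hl⟩) ≠ s(C.spine i, C.spine j) := by
    intro l hl h heq
    rw [Sym2.eq_iff, C.spineInj.eq_iff, C.spineInj.eq_iff, C.spineInj.eq_iff,
      C.spineInj.eq_iff] at heq
    simp only [Fin.ext_iff] at heq
    have : (i : ℕ) < j := hij
    omega
  by_contra! hki
  by_cases hj' : (j : ℕ) = i + 1
  · have h1 : (G.deleteEdges {s(C.spine i, C.spine j)}).Reachable (C.spine i) (C.spine k) := by
      have := (hA.preconnected ⟨_, hi⟩ ⟨_, hk⟩).map (G' := G.deleteEdges {s(C.spine i, C.spine j)})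
        ⟨Subtype.val, by
          intro a b hab
          rw [SimpleGraph.deleteEdges_adj]
          refine ⟨hab, fun h => ?_⟩
          have hmem : C.spine j ∈ s(a.1, b.1) := by
            rw [h]
            exact Sym2.mem_mk_right _ _
          rcases Sym2.mem_iff.1 hmem with h | h
          · exact hj (h ▸ a.2)
          · exact hj (h ▸ b.2)⟩
      exact this
    have h2 := C.reachable_spine s(C.spine i, C.spine j) (i := j) (k := k) (by omega) k.2
      fun l hl h1 h2 => hne l hl (by omega)
    exact hbridge (h1.trans h2.symm)
  · exact hbridge (C.reachable_spine _ (i := i) (k := j) (le_of_lt hij) j.2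
      fun l hl h1 h2 => hne l hl (by omega))

/-- A connected set with at least two vertices contains a spine vertex. -/
lemma SubCaterpillar.exists_spine_mem (hC : C.verts = Set.univ) {A : Set V}
    (hA : (G.induce A).Connected) (hcard : 2 ≤ A.ncard) : ∃ j, C.spine j ∈ A := by
  by_contra! hns
  have hclosed : ∀ u ∈ A, u ∈ Set.univ → ∀ w ∈ Set.univ, G.Adj u w → w ∈ A := by
    intro u hu _ w _ huw
    have hpend := C.pendant u (hC ▸ Set.mem_univ u) (by rintro ⟨j, rfl⟩; exact hns j hu)
    obtain ⟨c, hc⟩ := Set.ncard_eq_one.1 hpend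
    have hnbr : ∀ z, G.Adj u z → z = c := fun z hz => by
      have : z ∈ {w : V | w ∈ C.verts ∧ G.Adj u w} := ⟨hC ▸ Set.mem_univ z, hz⟩
      rwa [hc] at this
    have : Nontrivial A := Set.nontrivial_coe_sort.2
      (Set.one_lt_ncard_iff_nontrivial_and_finite.1 hcard).1
    obtain ⟨⟨z, hz⟩, huz⟩ := hA.preconnected.exists_adj_of_nontrivial ⟨u, hu⟩
    rw [hnbr w huw, ← hnbr z huz]
    exact hz
  obtain ⟨a, ha⟩ : A.Nonempty := Set.nonempty_of_ncard_ne_zero (by omega)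
  refine hns ⟨0, C.npos⟩ (compIn_subset_of_closed (fun _ => ha) hclosed
    ((reachable_induce_iff (G := G) (v := a) (Set.mem_univ _) (Set.mem_univ _)).1 ?_))
  exact (SimpleGraph.induceUnivIso G).symm.connected_iff.1
    (C.isTree_of_verts_eq_univ hC).connected _ _

/-- The spine vertices which are rightmost in their packed graph. -/
def rightEnds (C : SubCaterpillar G) (P : Finset (Set V)) : Set V :=
  {v | ∃ A ∈ P, ∃ j, C.spine j = v ∧ v ∈ A ∧ ∀ j', C.spine j' ∈ A → j' ≤ j}

lemma eq_of_mem_of_mem {P : Finset (Set V)} (hP : IsSTP G d C P) {A B : Set V} (hA : A ∈ P)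
    (hB : B ∈ P) {v : V} (hvA : v ∈ A) (hvB : v ∈ B) : A = B := by
  by_contra hne
  exact Set.disjoint_left.1 (hP.2.1 hA hB hne) hvA hvB

lemma ncard_rightEnds_le {P : Finset (Set V)} (hP : IsSTP G d C P) :
    (rightEnds C P).ncard ≤ cocOptOn G C.verts d := by
  rw [← hP.2.2.1, ← Set.ncard_coe_finset]
  refine Set.ncard_le_ncard_of_injOn
    (fun v => {w | ∃ A ∈ P, v ∈ A ∧ w ∈ A}) ?_ ?_ P.finite_toSet
  · rintro v ⟨A, hA, j, rfl, hvA, -⟩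
    have heq : {w | ∃ A ∈ P, C.spine j ∈ A ∧ w ∈ A} = A := by
      ext w
      constructor
      · rintro ⟨B, hB, hvB, hwB⟩
        exact eq_of_mem_of_mem hP hA hB hvA hvB ▸ hwB
      · exact fun hw => ⟨A, hA, hvA, hw⟩
    exact heq ▸ hA
  · rintro _ ⟨A, hA, j, rfl, hjA, hj⟩ _ ⟨B, hB, k, rfl, hkB, hk⟩ heq
    have hmem : C.spine k ∈ {w | ∃ A ∈ P, C.spine j ∈ A ∧ w ∈ A} := by
      rw [show {w | ∃ A ∈ P, C.spine j ∈ A ∧ w ∈ A} = _ from heq]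
      exact ⟨B, hB, hkB, hkB⟩
    obtain ⟨A', hA', hjA', hkA'⟩ := hmem
    obtain rfl := eq_of_mem_of_mem hP hA hA' hjA hjA'
    obtain rfl := eq_of_mem_of_mem hP hA hB hkA' hkB
    rw [le_antisymm (hk j hjA) (hj k hkB)]

/-- Neighbouring vertices outside the right ends lie in the same packed graph. -/
lemma mem_of_adj_of_notMem_rightEnds (hC : C.verts = Set.univ) {P : Finset (Set V)}
    (hP : IsSTP G d C P) (hcov : ⋃₀ (↑P : Set (Set V)) = C.verts) {A : Set V} (hA : A ∈ P)
    {u w : V} (huA : u ∈ A) (hu : u ∉ rightEnds C P) (hw : w ∉ rightEnds C P)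
    (huw : G.Adj u w) : w ∈ A := by
  obtain ⟨B, hB, hwB⟩ : w ∈ ⋃₀ (↑P : Set (Set V)) := by rw [hcov, hC]; trivial
  by_cases hAB : A = B
  · exact hAB ▸ hwB
  exfalso
  have hdisj := Set.disjoint_left.1 (hP.2.1 hA hB hAB)
  by_cases hus : u ∈ Set.range C.spine
  swap
  · exact hdisj huA (hP.2.2.2.1 B hB u (hC ▸ Set.mem_univ u) hus w hwB huw)
  by_cases hws : w ∈ Set.range C.spine
  swap
  · exact hdisj (hP.2.2.2.1 A hA w (hC ▸ Set.mem_univ w) hws u huA huw.symm) hwB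
  obtain ⟨i, rfl⟩ := hus
  obtain ⟨j, rfl⟩ := hws
  rcases lt_trichotomy i j with hij | rfl | hij
  · exact hu ⟨A, hA, i, rfl, huA, fun k hk => C.le_of_mem_of_adj_notMem hC
      (hP.1 A hA).2.2 hij huA (fun h => hdisj h hwB) huw hk⟩
  · exact huw.ne rfl
  · exact hw ⟨B, hB, j, rfl, hwB, fun k hk => C.le_of_mem_of_adj_notMem hC
      (hP.1 B hB).2.2 hij hwB (fun h => hdisj huA h) huw.symm hk⟩

lemma isCoc_rightEnds [Finite V] (hd : 1 ≤ d) (hC : C.verts = Set.univ) {P : Finset (Set V)}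
    (hP : IsSTP G d C P) (hcov : ⋃₀ (↑P : Set (Set V)) = C.verts) :
    IsCoc G d (rightEnds C P) := by
  intro v
  obtain ⟨A, hA, hvA⟩ : v ∈ ⋃₀ (↑P : Set (Set V)) := by rw [hcov, hC]; trivial
  obtain ⟨hAsub, hAcard, hAconn⟩ := hP.1 A hA
  obtain ⟨j₀, hj₀⟩ := C.exists_spine_mem hC hAconn (by omega)
  obtain ⟨j, hjA, hj⟩ := (Set.toFinite {j | C.spine j ∈ A}).exists_maximalFor id _ ⟨j₀, hj₀⟩
  have hmax : ∀ j', C.spine j' ∈ A → j' ≤ j := fun j' h' =>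
    (le_total j' j).elim id fun h => hj h' h
  have hjR : C.spine j ∈ rightEnds C P := ⟨A, hA, j, rfl, hjA, hmax⟩
  refine le_trans (Set.ncard_le_ncard ?_ (Set.toFinite _))
    (isCocSetOn_iff.1 (hP.2.2.2.2.2 A hA j hjA hmax) v)
  apply compIn_subset_of_closed
  · exact fun hv => mem_compIn_self ⟨hvA, fun h => hv (h ▸ hjR)⟩
  · intro a ha haR b hbR hab
    exact compIn_step ha hab ⟨mem_of_adj_of_notMem_rightEnds hC hP hcov hA
      (compIn_subset ha).1 haR hbR hab, fun h => hbR (h ▸ hjR)⟩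

/-- A caterpillar covered by a solution-tight packing has a minimum coc set containing the right
end of its spine. -/
lemma exists_isCoc_spine_last_mem [Finite V] (hd : 1 ≤ d) (hC : C.verts = Set.univ)
    (h : ∃ P : Finset (Set V), IsSTP G d C P ∧ ⋃₀ (↑P : Set (Set V)) = C.verts) :
    ∃ Z, IsCoc G d Z ∧ Z.ncard = cocOpt G d ∧
      C.spine ⟨C.n - 1, Nat.sub_lt C.npos Nat.one_pos⟩ ∈ Z := by
  obtain ⟨P, hP, hcov⟩ := h
  have hcoc := isCoc_rightEnds hd hC hP hcov
  refine ⟨rightEnds C P, hcoc, le_antisymm ?_ (cocOpt_le hcoc), ?_⟩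
  · rw [cocOpt, ← hC]
    exact ncard_rightEnds_le hP
  · obtain ⟨A, hA, hvA⟩ : C.spine ⟨C.n - 1, Nat.sub_lt C.npos Nat.one_pos⟩ ∈
        ⋃₀ (↑P : Set (Set V)) := by rw [hcov]; exact C.spineMem _
    exact ⟨A, hA, _, rfl, hvA, fun j' _ => Nat.le_sub_one_of_lt j'.2⟩

end packing

/-- Let `d ≥ 1`, let `C₁`, `C₂` be caterpillars whose solution-tight
packings contain all their vertices, with essences `γ₁`, `γ₂` and spines
`v_1,…,v_n` resp. `w_1,…,w_m`. Let `C` be the caterpillar obtained from the disjoint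
union of `C₁` and `C₂` by adding the edge `v_n w_1`, with the concatenated spine.
Then the essence `γ` of `C` satisfies `γ = γ₂ ∘ γ₁`. -/
theorem stmt13 {V₁ V₂ : Type} [Fintype V₁] [Fintype V₂] (d : ℕ) (hd : 1 ≤ d)
    (H₁ : SimpleGraph V₁) (H₂ : SimpleGraph V₂)
    (C₁ : SubCaterpillar H₁) (C₂ : SubCaterpillar H₂)
    (hv₁ : C₁.verts = Set.univ) (hv₂ : C₂.verts = Set.univ)
    (hfull₁ : ∃ Q : Finset (Set V₁), IsSTP H₁ d C₁ Q ∧ ⋃₀ (↑Q : Set (Set V₁)) = C₁.verts)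
    (hfull₂ : ∃ Q : Finset (Set V₂), IsSTP H₂ d C₂ Q ∧ ⋃₀ (↑Q : Set (Set V₂)) = C₂.verts)
    (C : SubCaterpillar (joinGraph H₁ H₂
      (C₁.spine ⟨C₁.n - 1, Nat.sub_lt C₁.npos Nat.one_pos⟩) (C₂.spine ⟨0, C₂.npos⟩)))
    (hCv : C.verts = Set.univ)
    (hCn : C.n = C₁.n + C₂.n)
    (hsp₁ : ∀ i : Fin C₁.n,
      C.spine ⟨(i : ℕ), by have := i.2; omega⟩ = Sum.inl (C₁.spine i))
    (hsp₂ : ∀ j : Fin C₂.n,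
      C.spine ⟨C₁.n + (j : ℕ), by have := j.2; omega⟩ = Sum.inr (C₂.spine j)) :
    ∀ x ≤ d + 1, C.essence d x = C₂.essence d (C₁.essence d x) := by
  intro x _
  have hfirst : C.spine ⟨0, C.npos⟩ = Sum.inl (C₁.spine ⟨0, C₁.npos⟩) := hsp₁ ⟨0, C₁.npos⟩
  have hlast : C.spine ⟨C.n - 1, Nat.sub_lt C.npos Nat.one_pos⟩ =
      Sum.inr (C₂.spine ⟨C₂.n - 1, Nat.sub_lt C₂.npos Nat.one_pos⟩) := by
    rw [← hsp₂]
    congr 1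
    rw [Fin.mk.injEq]
    have := C₂.npos
    change C.n - 1 = C₁.n + (C₂.n - 1)
    omega
  rw [C.essence_eq_graphEssence hCv hd, C₁.essence_eq_graphEssence hv₁ hd,
    C₂.essence_eq_graphEssence hv₂ hd, hfirst, hlast]
  exact graphEssence_join (exists_isCoc_spine_last_mem hd hv₁ hfull₁) _ _ x

end CocPaper
end

section
/- Let d ≥ 1 and let γ : {0,…,d+1} → {0,…,d+1} be any non-decreasing function with γ(0) = 0 and γ(d+1) = d+1. Then there exists a caterpillar C whose essence relative to d equals γ, such that the solution-tight packing 𝒞 of C contains all vertices of C and |𝒞| ≤ d³. -/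
namespace CocPaper

open SimpleGraph

variable {V : Type} {W : Type}

section ComponentSize

variable {G : SimpleGraph V} {A S : Set V} {d : ℕ}

theorem compSizeOn_eq_ncard_supp {v : V} (hv : v ∈ A \ S) :
    compSizeOn G A S v =
      ((G.induce (A \ S)).connectedComponentMk ⟨v, hv⟩).supp.ncard := by
  rw [← Set.ncard_image_of_injective _ Subtype.val_injective, compSizeOn]
  congr 1
  ext w
  constructor
  · rintro ⟨_, hw, h⟩
    exact ⟨⟨w, hw⟩, ConnectedComponent.sound h.symm, rfl⟩
  · rintro ⟨⟨w, hw⟩, h, rfl⟩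
    exact ⟨hv, hw, (ConnectedComponent.exact h).symm⟩

theorem compSizeOn_eq_zero {v : V} (hv : v ∉ A \ S) : compSizeOn G A S v = 0 := by
  rw [compSizeOn]
  convert Set.ncard_empty V
  ext w
  simp [hv]

theorem isCocSetOn_iff_compSizeOn_le :
    IsCocSetOn G A d S ↔ ∀ v, compSizeOn G A S v ≤ d := by
  constructor
  · intro h v
    by_cases hv : v ∈ A \ S
    · rw [compSizeOn_eq_ncard_supp hv]
      exact h _
    · simp [compSizeOn_eq_zero hv]
  · intro h c
    induction c using ConnectedComponent.ind with
    | h v =>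
      rw [← compSizeOn_eq_ncard_supp v.2]
      exact h v

/-- A set closed under adjacency in `G[A] - S` bounds the components it contains. -/
theorem compSizeOn_le_ncard [Finite V] {T : Set V} {v : V} (hvT : v ∈ T)
    (hT : ∀ u ∈ T, u ∈ A \ S → ∀ u' ∈ A \ S, G.Adj u u' → u' ∈ T) :
    compSizeOn G A S v ≤ T.ncard := by
  apply Set.ncard_le_ncard _ (Set.toFinite T)
  rintro w ⟨hv, hw, ⟨p⟩⟩
  have key : ∀ (a b : ↥(A \ S)), (G.induce (A \ S)).Walk a b → a.1 ∈ T → b.1 ∈ T := by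
    intro a b p
    induction p with
    | nil => exact id
    | cons h _ ih => exact fun ha => ih (hT _ ha (Subtype.prop _) _ (Subtype.prop _) h)
  exact key _ _ p hvT

theorem cocOptOn_le {m : ℕ} (hSA : S ⊆ A) (hS : IsCocSetOn G A d S) (hm : S.ncard = m) :
    cocOptOn G A d ≤ m :=
  Nat.sInf_le ⟨S, hSA, hS, hm⟩

theorem exists_isMinCocSetOn (G : SimpleGraph V) (A : Set V) (d : ℕ) :
    ∃ S, IsMinCocSetOn G A d S := by
  have hne : {m : ℕ | ∃ S : Set V, S ⊆ A ∧ IsCocSetOn G A d S ∧ S.ncard = m}.Nonempty := by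
    refine ⟨_, A, subset_rfl, isCocSetOn_iff_compSizeOn_le.2 fun v => ?_, rfl⟩
    simp [compSizeOn_eq_zero]
  obtain ⟨S, h1, h2, h3⟩ := Nat.sInf_mem hne
  exact ⟨S, h1, h2, h3⟩

end ComponentSize

/-- The edges, oriented away from their left or parent end, of a caterpillar with spine
`sp 1, …, sp n` whose vertices are arranged in levels by `lv`: level `k ≥ 1` consists of
`sp k` and its pendants, while level `0` consists of further pendants of `sp 1`. -/
def LevelEdge (n : ℕ) (lv : V → ℕ) (sp : ℕ → V) (u v : V) : Prop :=
  ∃ k, 1 ≤ k ∧ k ≤ n ∧ u = sp k ∧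
    ((lv v = k ∧ v ≠ sp k) ∨ (lv v = 0 ∧ k = 1) ∨ (k + 1 ≤ n ∧ v = sp (k + 1)))

/-- `G` is a caterpillar with spine `sp 1, …, sp n`, arranged in levels by `lv`, whose
`k`-th level has `μ k` vertices. -/
structure IsLeveledCaterpillar (G : SimpleGraph V) (n : ℕ) (μ : ℕ → ℕ) (lv : V → ℕ)
    (sp : ℕ → V) : Prop where
  lv_le : ∀ u, lv u ≤ n
  lv_sp : ∀ k, 1 ≤ k → k ≤ n → lv (sp k) = k
  adj_iff : ∀ u v, G.Adj u v ↔ LevelEdge n lv sp u v ∨ LevelEdge n lv sp v u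
  ncard_level : ∀ k ≤ n, {u | lv u = k}.ncard = μ k

namespace IsLeveledCaterpillar

variable {G : SimpleGraph V} {n : ℕ} {μ : ℕ → ℕ} {lv : V → ℕ} {sp : ℕ → V}

section

variable (M : IsLeveledCaterpillar G n μ lv sp)

include M

theorem ncard_levels [Finite V] {a b : ℕ} (hab : a ≤ b) (hb : b ≤ n + 1) :
    {u | a ≤ lv u ∧ lv u < b}.ncard = ∑ k ∈ Finset.Ico a b, μ k := by
  induction b, hab using Nat.le_induction with
  | base =>
    have : {u | a ≤ lv u ∧ lv u < a} = (∅ : Set V) := by ext; simp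
    simp [this]
  | succ b hab ih =>
    have hU : {u | a ≤ lv u ∧ lv u < b + 1} =
        {u | a ≤ lv u ∧ lv u < b} ∪ {u | lv u = b} := by
      ext u
      simp only [Set.mem_ofPred_eq, Set.mem_union]
      omega
    have hdisj : Disjoint {u | a ≤ lv u ∧ lv u < b} {u | lv u = b} := by
      rw [Set.disjoint_left]
      intro u h1 h2
      simp only [Set.mem_ofPred_eq] at h1 h2
      omega
    rw [hU, Set.ncard_union_eq hdisj, ih (by omega), M.ncard_level b (by omega),
      Finset.sum_Ico_succ_top hab]

theorem adj_sp_succ {k : ℕ} (h1 : 1 ≤ k) (h2 : k + 1 ≤ n) : G.Adj (sp k) (sp (k + 1)) :=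
  (M.adj_iff _ _).2 (Or.inl ⟨k, h1, by omega, rfl, Or.inr (Or.inr ⟨h2, rfl⟩)⟩)

/-- Consecutive levels whose spine vertices are kept lie in one component. -/
theorem reachable_induce {B : Set V} {a b : ℕ} (hb : 1 ≤ b) (hbn : b ≤ n)
    (hB : ∀ k, a ≤ k → 1 ≤ k → k ≤ b → sp k ∈ B) {u : V} (hu : u ∈ B) (hau : a ≤ lv u)
    (hub : lv u ≤ b) (hab : a ≤ b) :
    (G.induce B).Reachable ⟨u, hu⟩ ⟨sp b, hB b hab hb le_rfl⟩ := by
  have spine : ∀ i k, (hk : k + i = b) → (hak : a ≤ k) → (h1 : 1 ≤ k) →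
      (G.induce B).Reachable ⟨sp k, hB k hak h1 (by omega)⟩
        ⟨sp b, hB b hab hb le_rfl⟩ := by
    intro i
    induction i with
    | zero =>
      intro k hk hak h1
      obtain rfl : k = b := by omega
      exact Reachable.refl _
    | succ i ih =>
      intro k hk hak h1
      refine Reachable.trans (Adj.reachable ?_) (ih (k + 1) (by omega) (by omega) (by omega))
      exact M.adj_sp_succ h1 (by omega)
  rcases Nat.eq_zero_or_pos (lv u) with h0 | hpos
  · refine Reachable.trans (Adj.reachable ?_) (spine (b - 1) 1 (by omega) (by omega) le_rfl)
    exact (M.adj_iff _ _).2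
      (Or.inr ⟨1, le_rfl, by omega, rfl, Or.inr (Or.inl ⟨h0, rfl⟩)⟩)
  · by_cases hs : u = sp (lv u)
    · have := spine (b - lv u) (lv u) (by omega) hau hpos
      convert this using 2
    · refine Reachable.trans (Adj.reachable ?_)
        (spine (b - lv u) (lv u) (by omega) hau hpos)
      exact (M.adj_iff _ _).2
        (Or.inr ⟨lv u, hpos, by omega, rfl, Or.inl ⟨rfl, hs⟩⟩)

theorem ncard_levels_diff_le_compSizeOn [Finite V] {Y : Set V} {a b : ℕ} (hb : 1 ≤ b)
    (hbn : b ≤ n) (hab : a ≤ b) (hY : ∀ k, a ≤ k → 1 ≤ k → k ≤ b → sp k ∉ Y) :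
    ({u | a ≤ lv u ∧ lv u < b + 1} \ Y).ncard ≤ compSizeOn G Set.univ Y (sp b) := by
  apply Set.ncard_le_ncard _ (Set.toFinite _)
  rintro u ⟨⟨h1, h2⟩, h3⟩
  refine ⟨⟨trivial, hY b hab hb le_rfl⟩, ⟨trivial, h3⟩, ?_⟩
  exact (M.reachable_induce (B := Set.univ \ Y) hb hbn
    (fun k h h' h'' => ⟨trivial, hY k h h' h''⟩) ⟨trivial, h3⟩ h1 (by omega) hab).symm

theorem compSizeOn_le_ncard_levels [Finite V] {A S : Set V} {a b : ℕ}
    (ha : a = 0 ∨ ∀ u ∈ A \ S, lv u + 1 = a → 1 ≤ lv u ∧ u ≠ sp (lv u))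
    (hb : ∀ u ∈ A \ S, lv u = b → u ≠ sp b) {v : V} (hav : a ≤ lv v) (hvb : lv v < b) :
    compSizeOn G A S v ≤ {u | a ≤ lv u ∧ lv u < b}.ncard := by
  apply compSizeOn_le_ncard (show v ∈ {u | a ≤ lv u ∧ lv u < b} from ⟨hav, hvb⟩)
  rintro u ⟨hau, hub⟩ hu u' hu' hadj
  have hau' := fun h => hb u' hu' h
  have ha' := fun h => ha.imp_right fun h' => h' u' hu' h
  simp only [Set.mem_ofPred_eq]
  rcases (M.adj_iff _ _).1 hadj with ⟨k, h1, hn, rfl, h | h | ⟨h, rfl⟩⟩ |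
    ⟨k, h1, hn, rfl, h | h | ⟨h, rfl⟩⟩
  · rw [M.lv_sp k h1 hn] at *; omega
  · rw [M.lv_sp k h1 hn] at *
    refine ⟨?_, by omega⟩
    by_contra hlt
    rcases ha' (by omega) <;> omega
  · rw [M.lv_sp k h1 hn, M.lv_sp (k + 1) (by omega) h] at *
    refine ⟨by omega, ?_⟩
    by_contra hlt
    obtain rfl : k + 1 = b := by omega
    exact hau' rfl rfl
  · rw [M.lv_sp k h1 hn] at *; omega
  · rw [M.lv_sp k h1 hn] at *
    refine ⟨by omega, ?_⟩
    by_contra hlt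
    obtain rfl : k = b := by omega
    exact hau' rfl rfl
  · rw [M.lv_sp k h1 hn, M.lv_sp (k + 1) (by omega) h] at *
    refine ⟨?_, by omega⟩
    by_contra hlt
    rcases ha' (by omega) with h' | h'
    · omega
    · exact h'.2 rfl

theorem eq_sp_of_adj_pendant {u v : V} (h1 : 1 ≤ lv v) (hv : v ≠ sp (lv v))
    (h : G.Adj v u) : u = sp (lv v) := by
  rcases (M.adj_iff _ _).1 h with ⟨k, hk, hn, rfl, -⟩ |
    ⟨k, hk, hn, rfl, h' | h' | ⟨h', rfl⟩⟩
  · rw [M.lv_sp k hk hn] at hv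
    exact absurd rfl hv
  · rw [h'.1]
  · omega
  · rw [M.lv_sp _ (by omega) h'] at hv
    exact absurd rfl hv

theorem compSizeOn_pendant_le_one [Finite V] {A S : Set V} {v : V} (h1 : 1 ≤ lv v)
    (hv : v ≠ sp (lv v)) (hS : sp (lv v) ∉ A \ S) : compSizeOn G A S v ≤ 1 := by
  rw [← Set.ncard_singleton v]
  refine compSizeOn_le_ncard (Set.mem_singleton v) ?_
  rintro u rfl - u' hu' hadj
  rw [M.eq_sp_of_adj_pendant h1 hv hadj] at hu'
  exact absurd hu' hS

theorem connected [Nonempty V] (hn : 1 ≤ n) : G.Connected := by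
  have key : ∀ u, G.Reachable u (sp n) := by
    intro u
    have := M.reachable_induce (B := Set.univ) (a := 0) hn le_rfl (fun _ _ _ _ => trivial)
      (Set.mem_univ u) (Nat.zero_le _) (M.lv_le u) (Nat.zero_le _)
    exact this.map (Embedding.induce Set.univ).toHom
  exact ⟨fun u v => (key u).trans (key v).symm⟩

theorem isAcyclic (h0 : ∀ u, 1 ≤ lv u) : G.IsAcyclic := by
  have closed : ∀ (T : Set V) (u v : V), u ∈ T → v ∉ T →
      (∀ a ∈ T, ∀ b ∉ T, G.Adj a b → a = u ∧ b = v) → G.IsBridge s(u, v) := by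
    rintro T u v hu hv hT
    rw [isBridge_iff]
    rintro ⟨p⟩
    have key : ∀ a b, (G.deleteEdges {s(u, v)}).Walk a b → a ∈ T → b ∈ T := by
      intro a b p
      induction p with
      | nil => exact id
      | @cons a b c h _ ih =>
        intro ha
        apply ih
        by_contra hb
        rw [deleteEdges_adj] at h
        obtain ⟨rfl, rfl⟩ := hT a ha b hb h.1
        exact h.2 rfl
    exact hv (key _ _ p hu)
  have edge : ∀ u v, LevelEdge n lv sp u v → G.IsBridge s(u, v) := by
    rintro u v ⟨k, h1, hn, rfl, h | h | ⟨h, rfl⟩⟩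
    · rw [Sym2.eq_swap]
      obtain ⟨rfl, hne⟩ := h
      refine closed {v} _ _ rfl (fun h => hne h.symm) ?_
      rintro a rfl b - hab
      exact ⟨rfl, M.eq_sp_of_adj_pendant h1 hne hab⟩
    · have := h0 v
      omega
    · refine closed {x | lv x ≤ k} _ _ (M.lv_sp k h1 hn).le ?_ ?_
      · simp [M.lv_sp (k + 1) (by omega) h]
      · intro a ha b hb hab
        simp only [Set.mem_ofPred_eq] at ha hb
        rcases (M.adj_iff _ _).1 hab with ⟨l, h1', hn', rfl, h' | h' | ⟨h', rfl⟩⟩ |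
          ⟨l, h1', hn', rfl, h' | h' | ⟨h', rfl⟩⟩
        · rw [M.lv_sp l h1' hn'] at *; omega
        · omega
        · rw [M.lv_sp l h1' hn'] at ha
          rw [M.lv_sp (l + 1) (by omega) h'] at hb
          obtain rfl : l = k := by omega
          exact ⟨rfl, rfl⟩
        · rw [M.lv_sp l h1' hn'] at *; omega
        · have := h0 a; omega
        · rw [M.lv_sp l h1' hn'] at hb
          rw [M.lv_sp (l + 1) (by omega) h'] at ha
          omega
  rw [isAcyclic_iff_forall_isBridge]
  intro e
  induction e using Sym2.ind with
  | h u v =>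
    intro he
    rcases (M.adj_iff _ _).1 he with h | h
    · exact edge u v h
    · rw [Sym2.eq_swap]
      exact edge v u h

end

end IsLeveledCaterpillar

/-- The levels `a, …, b - 1`, of sizes `μ`, form one piece of the packing, and `f`
describes how it transforms the size `c` of the component arriving from its left: deleting
`sp i` is allowed when `c` and the levels before `i` have at most `d` vertices in total,
and passes the levels after `i` on to the right. -/
structure PieceSpec (d a b : ℕ) (μ f : ℕ → ℕ) : Prop where
  lt : a < b
  le_sum : d + 1 ≤ ∑ k ∈ Finset.Ico a b, μ k
  sum_le : ∑ k ∈ Finset.Ico a (b - 1), μ k ≤ d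
  le_of_allowed : ∀ c i, 1 ≤ c → a ≤ i → i < b → c + ∑ k ∈ Finset.Ico a i, μ k ≤ d →
    f c ≤ ∑ k ∈ Finset.Ico (i + 1) b, μ k
  exists_allowed : ∀ c ≤ d, f c ≤ d → ∃ i, a ≤ i ∧ i < b ∧
    c + ∑ k ∈ Finset.Ico a i, μ k ≤ d ∧ ∑ k ∈ Finset.Ico (i + 1) b, μ k = f c
  map_zero : f 0 = 0
  map_top : f (d + 1) = d + 1
  map_le : ∀ c ≤ d + 1, f c ≤ d + 1

/-- The levels `1, …, n` are divided into `m` consecutive pieces starting at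
`s 0, …, s (m - 1)`, the `j`-th of which realizes `f j`. -/
structure Layout (d m n : ℕ) (μ s : ℕ → ℕ) (f : ℕ → ℕ → ℕ) : Prop where
  mono : Monotone s
  zero : s 0 = 1
  last : s m = n + 1
  pos : ∀ k, 1 ≤ k → k ≤ n → 1 ≤ μ k
  piece : ∀ j < m, PieceSpec d (s j) (s (j + 1)) μ (f j)

/-- The composition `f (j - 1) ∘ ⋯ ∘ f 0`. -/
def iterComp (f : ℕ → ℕ → ℕ) : ℕ → ℕ → ℕ
  | 0, x => x
  | j + 1, x => f j (iterComp f j x)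

theorem iterComp_congr {f g : ℕ → ℕ → ℕ} {m : ℕ} (h : ∀ j < m, f j = g j) (x : ℕ) :
    iterComp f m x = iterComp g m x := by
  induction m with
  | zero => rfl
  | succ m ih =>
    rw [iterComp, iterComp, h m (by omega), ih fun j hj => h j (by omega)]

theorem PieceSpec.congr {d a b : ℕ} {μ ν f : ℕ → ℕ} (P : PieceSpec d a b μ f)
    (h : ∀ k, a ≤ k → k < b → ν k = μ k) : PieceSpec d a b ν f := by
  have key : ∀ i j, a ≤ i → j ≤ b →
      ∑ k ∈ Finset.Ico i j, ν k = ∑ k ∈ Finset.Ico i j, μ k := by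
    intro i j hi hj
    refine Finset.sum_congr rfl fun k hk => ?_
    rw [Finset.mem_Ico] at hk
    exact h k (by omega) (by omega)
  refine ⟨P.lt, ?_, ?_, ?_, ?_, P.map_zero, P.map_top, P.map_le⟩
  · rw [key a b le_rfl le_rfl]
    exact P.le_sum
  · rw [key a (b - 1) le_rfl (by omega)]
    exact P.sum_le
  · intro c i hc hai hib hle
    rw [key a i le_rfl hib.le] at hle
    rw [key (i + 1) b (by omega) le_rfl]
    exact P.le_of_allowed c i hc hai hib hle
  · intro c hc hfc
    obtain ⟨i, hai, hib, h1, h2⟩ := P.exists_allowed c hc hfc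
    rw [← key a i le_rfl hib.le] at h1
    rw [← key (i + 1) b (by omega) le_rfl] at h2
    exact ⟨i, hai, hib, h1, h2⟩

namespace Layout

variable {d m n : ℕ} {μ s : ℕ → ℕ} {f : ℕ → ℕ → ℕ}

theorem one_le (L : Layout d m n μ s f) (j : ℕ) : 1 ≤ s j := by
  rw [← L.zero]
  exact L.mono (Nat.zero_le j)

theorem le_of_le (L : Layout d m n μ s f) {j : ℕ} (hj : j ≤ m) : s j ≤ n + 1 := by
  rw [← L.last]
  exact L.mono hj

theorem congr {ν : ℕ → ℕ} (L : Layout d m n μ s f) (h : ∀ k, 1 ≤ k → ν k = μ k) :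
    Layout d m n ν s f := by
  refine ⟨L.mono, L.zero, L.last, fun k h1 hn => ?_, fun j hj => ?_⟩
  · rw [h k h1]
    exact L.pos k h1 hn
  · refine (L.piece j hj).congr fun k hk _ => h k ?_
    exact (L.one_le j).trans hk

theorem piece_unique (L : Layout d m n μ s f) {i j l : ℕ} (hi : s i ≤ l)
    (hi' : l < s (i + 1)) (hj : s j ≤ l) (hj' : l < s (j + 1)) : i = j := by
  rcases lt_trichotomy i j with h | h | h
  · have := L.mono (show i + 1 ≤ j from h)
    omega
  · exact h
  · have := L.mono (show j + 1 ≤ i from h)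
    omega

theorem exists_piece (L : Layout d m n μ s f) {l : ℕ} (h1 : 1 ≤ l) (hn : l ≤ n) :
    ∃ j < m, s j ≤ l ∧ l < s (j + 1) := by
  have key : ∀ i, l < s i → ∃ j < i, s j ≤ l ∧ l < s (j + 1) := by
    intro i
    induction i with
    | zero =>
      intro h
      rw [L.zero] at h
      omega
    | succ i ih =>
      intro h
      by_cases hi : l < s i
      · obtain ⟨j, hj, h⟩ := ih hi
        exact ⟨j, by omega, h⟩
      · exact ⟨i, by omega, by omega, h⟩
  exact key m (by rw [L.last]; omega)

theorem iterComp_zero (L : Layout d m n μ s f) {j : ℕ} (hj : j ≤ m) :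
    iterComp f j 0 = 0 := by
  induction j with
  | zero => rfl
  | succ j ih => rw [iterComp, ih (by omega), (L.piece j (by omega)).map_zero]

theorem iterComp_le (L : Layout d m n μ s f) {j x : ℕ} (hj : j ≤ m) (hx : x ≤ d + 1) :
    iterComp f j x ≤ d + 1 := by
  induction j with
  | zero => exact hx
  | succ j ih => exact (L.piece j (by omega)).map_le _ (ih (by omega))

theorem iterComp_le_of_le (L : Layout d m n μ s f) {x : ℕ} (hx : x ≤ d)
    (hm : iterComp f m x ≤ d) {j : ℕ} (hj : j ≤ m) : iterComp f j x ≤ d := by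
  induction hj using Nat.decreasingInduction with
  | self => exact hm
  | of_succ j hj ih =>
    by_contra hlt
    have h : iterComp f j x = d + 1 := by
      have := L.iterComp_le (j := j) (x := x) hj.le (by omega)
      omega
    rw [iterComp, h, (L.piece j hj).map_top] at ih
    omega

end Layout

namespace IsLeveledCaterpillar

variable {G : SimpleGraph V} {d m n : ℕ} {μ s : ℕ → ℕ} {lv : V → ℕ} {sp : ℕ → V}
  {f : ℕ → ℕ → ℕ} {Y : Set V}

section

variable [Finite V] (M : IsLeveledCaterpillar G n μ lv sp) (L : Layout d m n μ s f)
  (hY : IsCocSetOn G Set.univ d Y)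

include M L hY

omit L in
theorem ncard_levels_diff_le {a b : ℕ} (hb : 2 ≤ b) (hbn : b ≤ n + 1) (hab : a < b)
    (h : ∀ k, a ≤ k → 1 ≤ k → k < b → sp k ∉ Y) :
    ({u | a ≤ lv u ∧ lv u < b} \ Y).ncard ≤ d := by
  have h1 := M.ncard_levels_diff_le_compSizeOn (a := a) (b := b - 1) (Y := Y) (by omega)
    (by omega) (by omega) (fun k h1 h2 h3 => h k h1 h2 (by omega))
  rw [show b - 1 + 1 = b by omega] at h1
  exact h1.trans (isCocSetOn_iff_compSizeOn_le.1 hY _)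

omit L in
theorem sum_levels_le {a b : ℕ} (hb : 2 ≤ b) (hbn : b ≤ n + 1) (hab : a < b)
    (h : ∀ u, a ≤ lv u → lv u < b → u ∉ Y) :
    ∑ k ∈ Finset.Ico a b, μ k ≤ d := by
  rw [← M.ncard_levels hab.le hbn]
  refine le_of_eq_of_le ?_ (M.ncard_levels_diff_le hY hb hbn hab ?_)
  · congr 1
    ext u
    simp only [Set.mem_sdiff, Set.mem_ofPred_eq]
    exact ⟨fun h' => ⟨h', h u h'.1 h'.2⟩, fun h' => h'.1⟩
  · intro k h1 h2 h3
    have := M.lv_sp k h2 (by omega)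
    exact h _ (by omega) (by omega)

theorem exists_mem_piece {j : ℕ} (hj : j < m) :
    ∃ u ∈ Y, s j ≤ lv u ∧ lv u < s (j + 1) := by
  by_contra! hno
  have P := L.piece j hj
  have h1 := L.one_le j
  have h2 := P.lt
  have h3 := P.le_sum
  have h4 := M.sum_levels_le hY (a := s j) (b := s (j + 1)) (by omega)
    (L.le_of_le (by omega)) h2 fun u hu hu' huY => by
      have := hno u huY hu
      omega
  omega

theorem exists_selector :
    ∃ u : Fin m → V, Function.Injective u ∧
      ∀ j : Fin m, u j ∈ Y ∧ s j ≤ lv (u j) ∧ lv (u j) < s (j + 1) := by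
  choose u hu using fun j : Fin m => M.exists_mem_piece L hY j.2
  refine ⟨u, fun i j hij => ?_, hu⟩
  have hi := hu i
  have hj := hu j
  rw [hij] at hi
  exact Fin.ext (L.piece_unique hi.2.1 hi.2.2 hj.2.1 hj.2.2)

theorem le_ncard : m ≤ Y.ncard := by
  obtain ⟨u, hinj, hu⟩ := M.exists_selector L hY
  have h : Set.range u ⊆ Y := by
    rintro _ ⟨j, rfl⟩
    exact (hu j).1
  calc
    m = (Set.range u).ncard := by
      rw [← Set.image_univ, Set.ncard_image_of_injective _ hinj, Set.ncard_univ, Nat.card_fin]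
    _ ≤ Y.ncard := Set.ncard_le_ncard h (Set.toFinite Y)

theorem existsUnique_of_ncard_eq (hm : Y.ncard = m) :
    (∀ u ∈ Y, 1 ≤ lv u) ∧ ∀ j < m, ∃ v ∈ Y, s j ≤ lv v ∧ lv v < s (j + 1) ∧
      ∀ u ∈ Y, s j ≤ lv u → lv u < s (j + 1) → u = v := by
  obtain ⟨u, hinj, hu⟩ := M.exists_selector L hY
  have h : Set.range u = Y := by
    refine Set.eq_of_subset_of_ncard_le ?_ ?_ (Set.toFinite Y)
    · rintro _ ⟨j, rfl⟩
      exact (hu j).1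
    · rw [← Set.image_univ, Set.ncard_image_of_injective _ hinj, Set.ncard_univ, Nat.card_fin,
        hm]
  constructor
  · rw [← h]
    rintro _ ⟨j, rfl⟩
    exact (L.one_le j).trans (hu j).2.1
  · intro j hj
    refine ⟨u ⟨j, hj⟩, (hu _).1, (hu ⟨j, hj⟩).2.1, (hu ⟨j, hj⟩).2.2, ?_⟩
    rw [← h]
    rintro _ ⟨i, rfl⟩ h1 h2
    congr
    exact Fin.ext (L.piece_unique (hu i).2.1 (hu i).2.2 h1 h2)

/-- The component that reaches the `j`-th piece from the left is at least as large as
the composition of the functions of the preceding pieces predicts. -/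
theorem iterComp_eq_zero_or_exists (hm : Y.ncard = m) (h0 : μ 0 ≤ d) {j : ℕ}
    (hj : j ≤ m) :
    iterComp f j (μ 0) = 0 ∨ (iterComp f j (μ 0) ≤ d ∧ ∃ e ≤ s j,
      (∀ u, e ≤ lv u → lv u < s j → u ∉ Y) ∧
      iterComp f j (μ 0) ≤ ∑ k ∈ Finset.Ico e (s j), μ k) := by
  obtain ⟨hpos, huniq⟩ := M.existsUnique_of_ncard_eq L hY hm
  induction j with
  | zero =>
    refine Or.inr ⟨h0, 0, Nat.zero_le _, fun u _ hu huY => ?_, ?_⟩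
    · have := hpos u huY
      rw [L.zero] at hu
      omega
    · rw [L.zero]
      simp [iterComp]
  | succ j ih =>
    have P := L.piece j hj
    have h1 := L.one_le j
    have hlt := P.lt
    have hbn := L.le_of_le hj
    rw [iterComp]
    rcases Nat.eq_zero_or_pos (iterComp f j (μ 0)) with hc | hc
    · exact Or.inl (by rw [hc, P.map_zero])
    rcases ih (by omega) with hc' | ⟨hcd, e, hej, heY, hce⟩
    · omega
    right
    obtain ⟨v, hvY, hv1, hv2, hv⟩ := huniq j hj
    have hvs : v = sp (lv v) := by
      by_contra hvs
      have hsum := M.ncard_levels_diff_le hY (a := e) (b := s (j + 1)) (by omega) hbn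
        (by omega) fun k hk1 hk2 hk3 hk => by
          have hlv := M.lv_sp k hk2 (by omega)
          by_cases hkj : k < s j
          · exact heY _ (by omega) (by omega) hk
          · have := hv _ hk (by omega) (by omega)
            subst this
            exact hvs (by rw [hlv])
      have hsub : {u | e ≤ lv u ∧ lv u < s (j + 1)} \ Y =
          {u | e ≤ lv u ∧ lv u < s (j + 1)} \ {v} := by
        ext u
        simp only [Set.mem_sdiff, Set.mem_ofPred_eq, Set.mem_singleton_iff]
        refine and_congr_right fun hu => not_congr ⟨fun huY => ?_, fun h => h ▸ hvY⟩
        by_cases hkj : lv u < s j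
        · exact absurd huY (heY u hu.1 hkj)
        · exact hv u huY (by omega) hu.2
      have hvmem : v ∈ {u | e ≤ lv u ∧ lv u < s (j + 1)} := ⟨by omega, hv2⟩
      rw [hsub, Set.ncard_sdiff_singleton_of_mem hvmem,
        M.ncard_levels (by omega) hbn, ← Finset.sum_Ico_consecutive _ hej hlt.le] at hsum
      have := P.le_sum
      omega
    have hvn := M.lv_le v
    have hallow : iterComp f j (μ 0) + ∑ k ∈ Finset.Ico (s j) (lv v), μ k ≤ d := by
      rcases hv1.eq_or_lt with h | h
      · simpa [← h] using hcd
      · have hsum := M.sum_levels_le hY (a := e) (b := lv v) (by omega) (by omega)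
          (by omega) fun u hu1 hu2 huY => by
            by_cases hkj : lv u < s j
            · exact heY u hu1 hkj huY
            · have := hv u huY (by omega) (by omega)
              rw [this] at hu2
              exact lt_irrefl _ hu2
        rw [← Finset.sum_Ico_consecutive _ hej hv1] at hsum
        omega
    have hle := P.le_of_allowed _ (lv v) hc hv1 hv2 hallow
    have hfree : ∀ u, lv v + 1 ≤ lv u → lv u < s (j + 1) → u ∉ Y := by
      intro u hu1 hu2 huY
      have := hv u huY (by omega) hu2
      rw [this] at hu1
      omega
    refine ⟨hle.trans ?_, lv v + 1, hv2, hfree, hle⟩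
    rcases (show lv v + 1 ≤ s (j + 1) from hv2).eq_or_lt with h | h
    · simp [h]
    · exact M.sum_levels_le hY (by omega) hbn h hfree

theorem iterComp_le_compSizeOn (hn : 1 ≤ n) (hm : Y.ncard = m) (h0 : μ 0 ≤ d) :
    iterComp f m (μ 0) ≤ d ∧ iterComp f m (μ 0) ≤ compSizeOn G Set.univ Y (sp n) := by
  rcases M.iterComp_eq_zero_or_exists L hY hm h0 le_rfl with h | ⟨h1, e, he, hfree, h2⟩
  · omega
  refine ⟨h1, ?_⟩
  rw [L.last] at h2 he hfree
  by_cases hen : e ≤ n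
  · refine h2.trans ?_
    rw [← M.ncard_levels he le_rfl]
    refine le_of_eq_of_le ?_ (M.ncard_levels_diff_le_compSizeOn hn le_rfl hen ?_)
    · congr 1
      ext u
      simp only [Set.mem_sdiff, Set.mem_ofPred_eq]
      exact ⟨fun h' => ⟨h', hfree u h'.1 h'.2⟩, fun h' => h'.1⟩
    · intro k hk1 hk2 hk3
      have := M.lv_sp k hk2 hk3
      exact hfree _ (by omega) (by omega)
  · obtain rfl : e = n + 1 := by omega
    simp only [Finset.Ico_self, Finset.sum_empty] at h2
    omega

end

end IsLeveledCaterpillar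

namespace IsLeveledCaterpillar

variable {G : SimpleGraph V} {d m n : ℕ} {μ s : ℕ → ℕ} {lv : V → ℕ} {sp : ℕ → V}
  {f : ℕ → ℕ → ℕ}

section

variable [Finite V] (M : IsLeveledCaterpillar G n μ lv sp) (L : Layout d m n μ s f)

include M L

theorem exists_isCocSetOn (hd : 1 ≤ d) (hn : 1 ≤ n) (h0 : μ 0 ≤ d)
    (hf : iterComp f m (μ 0) ≤ d) :
    ∃ Y, IsCocSetOn G Set.univ d Y ∧ Y.ncard = m ∧
      compSizeOn G Set.univ Y (sp n) = iterComp f m (μ 0) := by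
  have hle := fun j hj => L.iterComp_le_of_le h0 hf (j := j) hj
  have hex : ∀ j : Fin m, ∃ i, s j ≤ i ∧ i < s (j + 1) ∧
      iterComp f j (μ 0) + ∑ k ∈ Finset.Ico (s j) i, μ k ≤ d ∧
      ∑ k ∈ Finset.Ico (i + 1) (s (j + 1)), μ k = iterComp f (j + 1) (μ 0) := fun j =>
    (L.piece j j.2).exists_allowed _ (hle j j.2.le) (hle (j + 1) j.2)
  choose y hy1 hy2 hy3 hy4 using hex
  have hy1' : ∀ j, 1 ≤ y j := fun j => (L.one_le j).trans (hy1 j)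
  have hyn : ∀ j, y j ≤ n := fun j => by
    have := L.le_of_le (show (j : ℕ) + 1 ≤ m from j.2)
    have := hy2 j
    omega
  have hlv : ∀ j, lv (sp (y j)) = y j := fun j => M.lv_sp _ (hy1' j) (hyn j)
  have hinj : Function.Injective fun j => sp (y j) := by
    intro i j hij
    have : y i = y j := by rw [← hlv i, ← hlv j]; exact congrArg lv hij
    exact Fin.ext (L.piece_unique (hy1 i) (hy2 i) (this ▸ hy1 j) (this ▸ hy2 j))
  set Y := Set.range fun j => sp (y j) with hYdef
  have hYm : Y.ncard = m := by
    rw [hYdef, ← Set.image_univ, Set.ncard_image_of_injective _ hinj, Set.ncard_univ,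
      Nat.card_fin]
  have hmem : ∀ j, sp (y j) ∈ Y := fun j => ⟨j, rfl⟩
  -- the left end of the run of levels before the `j`-th deleted vertex
  have hleft : ∀ j ≤ m, ∃ z ≤ s j, (∀ l, z ≤ l ∨ ∃ i : Fin m, (i : ℕ) < j ∧ l ≤ y i) ∧
      (z = 0 ∨ ∃ i : Fin m, (i : ℕ) + 1 = j ∧ z = y i + 1) ∧
      ∑ k ∈ Finset.Ico z (s j), μ k = iterComp f j (μ 0) := by
    intro j hj
    cases j with
    | zero =>
      refine ⟨0, Nat.zero_le _, fun l => Or.inl (Nat.zero_le l), Or.inl rfl, ?_⟩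
      simp [L.zero, iterComp]
    | succ j =>
      refine ⟨y ⟨j, hj⟩ + 1, hy2 ⟨j, hj⟩, fun l => ?_, Or.inr ⟨⟨j, hj⟩, rfl, rfl⟩, hy4 ⟨j, hj⟩⟩
      by_cases hl : y ⟨j, hj⟩ + 1 ≤ l
      · exact Or.inl hl
      · exact Or.inr ⟨⟨j, hj⟩, Nat.lt_succ_self j, by omega⟩
  have hclosed : ∀ z, (z = 0 ∨ ∃ i, z = y i + 1) →
      z = 0 ∨ ∀ u ∈ Set.univ \ Y, lv u + 1 = z → 1 ≤ lv u ∧ u ≠ sp (lv u) := by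
    rintro z (h | ⟨i, rfl⟩)
    · exact Or.inl h
    · refine Or.inr fun u hu hui => ?_
      have hui : lv u = y i := by omega
      refine ⟨hui ▸ hy1' i, fun h => hu.2 ?_⟩
      rw [h, hui]
      exact hmem i
  have hlast : ∀ v, (∀ i, y i < lv v) → compSizeOn G Set.univ Y v ≤ iterComp f m (μ 0) := by
    intro v hv
    obtain ⟨z, hz, hcov, hzc, hsum⟩ := hleft m le_rfl
    rw [L.last] at hz hsum
    rw [← hsum, ← M.ncard_levels hz le_rfl]
    refine M.compSizeOn_le_ncard_levels (hclosed z (hzc.imp_right ?_)) ?_ ?_ ?_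
    · rintro ⟨i, -, hi⟩
      exact ⟨i, hi⟩
    · intro u _ hu
      have := M.lv_le u
      omega
    · rcases hcov (lv v) with h | ⟨i, -, hi⟩
      · exact h
      · have := hv i
        omega
    · have := M.lv_le v
      omega
  have hcoc : IsCocSetOn G Set.univ d Y := by
    rw [isCocSetOn_iff_compSizeOn_le]
    intro v
    by_cases hv : ∀ i, y i < lv v
    · exact (hlast v hv).trans hf
    push Not at hv
    obtain ⟨j, hj, hjmin⟩ := WellFounded.has_min (wellFounded_lt (α := Fin m)) {i | lv v ≤ y i} hv
    rcases (show lv v ≤ y j from hj).eq_or_lt with heq | hlt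
    · by_cases hvs : v = sp (lv v)
      · rw [compSizeOn_eq_zero]
        · exact Nat.zero_le d
        · rw [hvs, heq]
          exact fun h => h.2 (hmem j)
      · refine (M.compSizeOn_pendant_le_one (heq ▸ hy1' j) hvs ?_).trans hd
        rw [heq]
        exact fun h => h.2 (hmem j)
    · obtain ⟨z, hz, hcov, hzc, hsum⟩ := hleft j j.2.le
      refine le_trans ?_ (hy3 j)
      have hyjn := hyn j
      rw [← hsum, Finset.sum_Ico_consecutive _ hz (hy1 j),
        ← M.ncard_levels (hz.trans (hy1 j)) (by omega)]
      refine M.compSizeOn_le_ncard_levels (hclosed z (hzc.imp_right ?_)) ?_ ?_ hlt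
      · rintro ⟨i, -, hi⟩
        exact ⟨i, hi⟩
      · rintro u hu - rfl
        exact hu.2 (hmem j)
      · rcases hcov (lv v) with h | ⟨i, hij, hi⟩
        · exact h
        · exact absurd hij (hjmin i hi)
  refine ⟨Y, hcoc, hYm, le_antisymm ?_ (M.iterComp_le_compSizeOn L hcoc hn hYm h0).2⟩
  by_cases hsn : sp n ∈ Y
  · rw [compSizeOn_eq_zero fun h => h.2 hsn]
    exact Nat.zero_le _
  · refine hlast _ fun i => ?_
    rw [M.lv_sp n hn le_rfl]
    refine lt_of_le_of_ne (hyn i) fun h => hsn ?_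
    rw [← h]
    exact hmem i

theorem cocOptOn_eq_iff (hd : 1 ≤ d) (hn : 1 ≤ n) (h0 : μ 0 ≤ d) :
    cocOptOn G Set.univ d = m ↔ iterComp f m (μ 0) ≤ d := by
  obtain ⟨S, -, hS, hSm⟩ := exists_isMinCocSetOn G Set.univ d
  constructor
  · intro h
    exact (M.iterComp_le_compSizeOn L hS hn (hSm.trans h) h0).1
  · intro h
    obtain ⟨Y, hY, hYm, -⟩ := M.exists_isCocSetOn L hd hn h0 h
    refine le_antisymm (cocOptOn_le (Set.subset_univ Y) hY hYm) ?_
    rw [← hSm]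
    exact M.le_ncard L hS

theorem sInf_compSizeOn_eq (hd : 1 ≤ d) (hn : 1 ≤ n) (h0 : μ 0 ≤ d)
    (hf : iterComp f m (μ 0) ≤ d) :
    sInf {b : ℕ | ∃ Y : Set V, IsMinCocSetOn G Set.univ d Y ∧
      b = compSizeOn G Set.univ Y (sp n)} = iterComp f m (μ 0) := by
  have hopt := (M.cocOptOn_eq_iff L hd hn h0).2 hf
  obtain ⟨Y, hY, hYm, hYc⟩ := M.exists_isCocSetOn L hd hn h0 hf
  refine IsLeast.csInf_eq ⟨⟨Y, ⟨Set.subset_univ Y, hY, hYm.trans hopt.symm⟩, hYc.symm⟩, ?_⟩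
  rintro _ ⟨Z, ⟨-, hZ, hZm⟩, rfl⟩
  exact (M.iterComp_le_compSizeOn L hZ hn (hZm.trans hopt) h0).2

end

theorem one_le_lv [Finite V] (M : IsLeveledCaterpillar G n μ lv sp) (h0 : μ 0 = 0) (u : V) :
    1 ≤ lv u := by
  by_contra hu
  have h := M.ncard_level 0 (Nat.zero_le n)
  rw [h0, Set.ncard_eq_zero (Set.toFinite _)] at h
  exact (h ▸ (show u ∈ {u | lv u = 0} by change lv u = 0; omega) : u ∈ (∅ : Set V))

theorem attachPendants_induce [Finite V] (M : IsLeveledCaterpillar G n μ lv sp) (h0 : μ 0 = 0)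
    (hn : 1 ≤ n) {v : ↥(Set.univ : Set V)} (hv : v.1 = sp 1) (x : ℕ) :
    IsLeveledCaterpillar (attachPendants (G.induce Set.univ) v x) n (Function.update μ 0 x)
      (Sum.elim (fun u => lv u.1) fun _ => 0) (fun k => Sum.inl ⟨sp k, trivial⟩) := by
  have hlv0 : ∀ u, lv u ≠ 0 := fun u => Nat.one_le_iff_ne_zero.1 (M.one_le_lv h0 u)
  refine ⟨?_, M.lv_sp, ?_, ?_⟩
  · rintro (u | i)
    · exact M.lv_le u
    · exact Nat.zero_le n
  · obtain ⟨v, hv'⟩ := v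
    obtain rfl : v = sp 1 := hv
    have hinl : ∀ u w : ↥(Set.univ : Set V),
        LevelEdge n (Sum.elim (fun u : ↥(Set.univ : Set V) => lv u.1) fun _ : Fin x => 0)
          (fun k => Sum.inl ⟨sp k, trivial⟩) (Sum.inl u) (Sum.inl w) ↔
        LevelEdge n lv sp u.1 w.1 := by
      rintro ⟨u, _⟩ ⟨w, _⟩
      simp [LevelEdge, Subtype.ext_iff]
    rintro (u | i) (w | j)
    · rw [hinl, hinl, ← M.adj_iff]
      simp only [attachPendants, fromRel_adj, Sum.inl.injEq, reduceCtorEq, and_false,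
        exists_false, or_false]
      constructor
      · rintro ⟨-, ⟨a, b, rfl, rfl, h⟩ | ⟨a, b, rfl, rfl, h⟩⟩
        · exact h
        · exact h.symm
      · intro h
        exact ⟨fun h' => h.ne (by rw [Sum.inl.inj h']), Or.inl ⟨u, w, rfl, rfl, h⟩⟩
    · simp [attachPendants, LevelEdge, Subtype.ext_iff]
      constructor
      · intro h
        exact ⟨1, le_rfl, hn, h, Or.inr rfl⟩
      · rintro ⟨k, hk, _, h, h'⟩
        obtain rfl : k = 1 := by omega
        exact h
    · simp [attachPendants, LevelEdge, Subtype.ext_iff]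
      constructor
      · intro h
        exact ⟨1, le_rfl, hn, h, Or.inr rfl⟩
      · rintro ⟨k, hk, _, h, h'⟩
        obtain rfl : k = 1 := by omega
        exact h
    · simp [attachPendants, LevelEdge]
  · intro k hk
    rcases Nat.eq_zero_or_pos k with rfl | hpos
    · have : {u : ↥(Set.univ : Set V) ⊕ Fin x |
          Sum.elim (fun u => lv u.1) (fun _ => 0) u = 0} = Set.range Sum.inr := by
        ext (u | i)
        · simp [hlv0]
        · simp
      rw [this, ← Set.image_univ, Set.ncard_image_of_injective _ Sum.inr_injective,
        Set.ncard_univ, Nat.card_fin, Function.update_self]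
    · have : {u : ↥(Set.univ : Set V) ⊕ Fin x |
          Sum.elim (fun u => lv u.1) (fun _ => 0) u = k} =
          (fun u => Sum.inl ⟨u, trivial⟩) '' {u | lv u = k} := by
        ext (u | i)
        · constructor
          · intro h
            exact ⟨u.1, h, rfl⟩
          · rintro ⟨a, h, h'⟩
            rw [← Sum.inl.inj h']
            exact h
        · simp [hpos.ne]
      rw [this, Set.ncard_image_of_injective, Function.update_of_ne hpos.ne', M.ncard_level k hk]
      intro a b hab
      exact congrArg Subtype.val (Sum.inl.inj hab)

end IsLeveledCaterpillar

section Pieces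

/-- `f` is realized by a piece of `l` levels, all of them singletons except for the
`p`-th, whose spine vertex has `q` pendants. -/
def IsPieceFun (d : ℕ) (f : ℕ → ℕ) : Prop :=
  ∃ l p q, p < l ∧ ∀ a, PieceSpec d a (a + l) (fun k => if k = a + p then q + 1 else 1) f

theorem sum_Ico_ite_succ_one (c q a b : ℕ) :
    ∑ k ∈ Finset.Ico a b, (if k = c then q + 1 else 1) =
      (b - a) + if a ≤ c ∧ c < b then q else 0 := by
  have h : ∀ k, (if k = c then q + 1 else 1) = 1 + if k = c then q else 0 := by
    intro k
    split_ifs <;> omega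
  simp_rw [h, Finset.sum_add_distrib, Finset.sum_ite_eq', Finset.mem_Ico]
  simp

theorem isPieceFun_decIJ {d i j : ℕ} (hij : i ≤ j) (hj : j ≤ d) : IsPieceFun d (decIJ i j) := by
  refine ⟨d - j + 1 + i, d - j, j - i, by omega, fun a => ?_⟩
  constructor
  · omega
  · rw [sum_Ico_ite_succ_one]
    split_ifs <;> omega
  · rw [sum_Ico_ite_succ_one]
    split_ifs <;> omega
  · intro c k hc hak hkb h
    rw [sum_Ico_ite_succ_one] at h ⊢
    unfold decIJ
    split_ifs at h ⊢ <;> omega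
  · intro c hc hfc
    simp_rw [sum_Ico_ite_succ_one]
    unfold decIJ at hfc ⊢
    by_cases h : i ≤ c ∧ c ≤ j
    · refine ⟨a + (d - j), ?_⟩
      simp only [h, and_self, if_true]
      split_ifs <;> omega
    · simp only [h, if_false]
      by_cases h' : j < c
      · refine ⟨a + (d - c), ?_⟩
        split_ifs <;> omega
      · refine ⟨a + (d - j + i - c), ?_⟩
        split_ifs <;> omega
  · unfold decIJ
    split_ifs <;> omega
  · unfold decIJ
    split_ifs <;> omega
  · intro c hc
    unfold decIJ
    split_ifs <;> omega

/-- The function on `{0, …, d + 1}` that adds `t` to all nonzero inputs, capped at `d + 1`. -/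
def shiftBy (d t : ℕ) : ℕ → ℕ := fun x => if x = 0 then 0 else min (x + t) (d + 1)

theorem isPieceFun_shiftBy (d t : ℕ) : IsPieceFun d (shiftBy d t) := by
  refine ⟨d + 1, d, t, by omega, fun a => ?_⟩
  constructor
  · omega
  · rw [sum_Ico_ite_succ_one]
    split_ifs <;> omega
  · rw [sum_Ico_ite_succ_one]
    split_ifs <;> omega
  · intro c k hc hak hkb h
    rw [sum_Ico_ite_succ_one] at h ⊢
    unfold shiftBy
    split_ifs at h ⊢ <;> omega
  · intro c hc hfc
    simp_rw [sum_Ico_ite_succ_one]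
    unfold shiftBy at hfc ⊢
    refine ⟨a + (d - c), ?_⟩
    split_ifs at hfc ⊢ <;> omega
  · simp [shiftBy]
  · unfold shiftBy
    split_ifs <;> omega
  · intro c hc
    unfold shiftBy
    split_ifs <;> omega

theorem exists_layout {d m : ℕ} {f : ℕ → ℕ → ℕ} (hf : ∀ j < m, IsPieceFun d (f j)) :
    ∃ n μ s, Layout d m n μ s f ∧ μ 0 = 0 := by
  induction m with
  | zero =>
    refine ⟨0, fun _ => 0, fun _ => 1, ⟨monotone_const, rfl, rfl, ?_, ?_⟩, rfl⟩
    · intro k h1 h2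
      omega
    · intro j hj
      omega
  | succ m ih =>
    obtain ⟨n, μ, s, L, h0⟩ := ih fun j hj => hf j (by omega)
    obtain ⟨l, p, q, hpl, hP⟩ := hf m (by omega)
    refine ⟨n + l, fun k => if k ≤ n then μ k else if k = n + 1 + p then q + 1 else 1,
      fun j => if j ≤ m then s j else n + 1 + l, ⟨?_, ?_, ?_, ?_, ?_⟩, ?_⟩
    · intro i j hij
      have h1 := L.mono hij
      dsimp only
      split_ifs with hi hj
      · exact h1
      · have := L.le_of_le hi
        omega
      · omega
      · omega
    · simp [L.zero]
    · simp
      omega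
    · intro k h1 hk
      have := L.pos k h1
      split_ifs <;> omega
    · intro j hj
      rcases (show j ≤ m by omega).eq_or_lt with rfl | hlt
      · simp only [le_refl, if_true, show ¬ j + 1 ≤ j by omega, if_false, L.last]
        refine (hP (n + 1)).congr fun k hk _ => ?_
        simp [show ¬ k ≤ n by omega]
      · simp only [hlt.le, show j + 1 ≤ m from hlt, if_true]
        refine (L.piece j hlt).congr fun k _ hk => ?_
        have := L.le_of_le (show j + 1 ≤ m from hlt)
        simp [show k ≤ n by omega]
    · simp [h0]

theorem iterComp_add (f : ℕ → ℕ → ℕ) (a b x : ℕ) :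
    iterComp f (a + b) x = iterComp (fun j => f (a + j)) b (iterComp f a x) := by
  induction b with
  | zero => rfl
  | succ b ih => rw [← add_assoc, iterComp, iterComp, ih]

/-- A monotone function with `g x ≤ x` is obtained by adjusting the values one by one. -/
theorem iterComp_decIJ {d : ℕ} {g : ℕ → ℕ} (hg : ∀ x ≤ d, g x ≤ x)
    (hmono : ∀ x y, x ≤ y → y ≤ d → g x ≤ g y) {N : ℕ} (hN : N ≤ d) (x : ℕ) :
    iterComp (fun j => decIJ (g (j + 1)) (j + 1)) N x = if x ≤ N then g x else x := by
  induction N with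
  | zero =>
    have := hg 0
    rw [iterComp]
    split_ifs with h
    · obtain rfl : x = 0 := by omega
      omega
    · rfl
  | succ N ih =>
    rw [iterComp, ih (by omega), decIJ]
    have h1 := hg (N + 1) hN
    rcases lt_trichotomy x (N + 1) with h | rfl | h
    · have h2 := hmono x (N + 1) h.le hN
      have h3 := hg x (by omega)
      split_ifs <;> omega
    · simp [h1]
    · split_ifs <;> omega

/-- A monotone function factors as a compression, a shift and a monotone decrease. -/
theorem exists_shift_factorization {d : ℕ} {γ : ℕ → ℕ}
    (hdom : ∀ x ≤ d + 1, γ x ≤ d + 1)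
    (hmono : ∀ x y : ℕ, x ≤ y → y ≤ d + 1 → γ x ≤ γ y)
    (h0 : γ 0 = 0) (htop : γ (d + 1) = d + 1) :
    ∃ (κ ℓ : ℕ → ℕ) (t : ℕ), (∀ x ≤ d, κ x ≤ x) ∧
      (∀ x y, x ≤ y → y ≤ d → κ x ≤ κ y) ∧ (∀ x ≤ d, ℓ x ≤ x) ∧
      (∀ x y, x ≤ y → y ≤ d → ℓ x ≤ ℓ y) ∧
      ∀ x ≤ d, (shiftBy d t (κ x) ≤ d ∧ ℓ (shiftBy d t (κ x)) = γ x) ∨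
        (shiftBy d t (κ x) = d + 1 ∧ γ x = d + 1) := by
  set I := ((Finset.range (d + 2)).image γ).filter fun v => 1 ≤ v with hI
  have hmemI : ∀ x ≤ d + 1, 1 ≤ γ x → γ x ∈ I := by
    intro x hx h
    rw [hI, Finset.mem_filter]
    exact ⟨Finset.mem_image_of_mem γ (Finset.mem_range.2 (by omega)), h⟩
  have hIle : ∀ v ∈ I, 1 ≤ v ∧ v ≤ d + 1 := by
    intro v hv
    rw [hI, Finset.mem_filter, Finset.mem_image] at hv
    obtain ⟨⟨x, hx, rfl⟩, h⟩ := hv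
    rw [Finset.mem_range] at hx
    exact ⟨h, hdom x (by omega)⟩
  set κ : ℕ → ℕ := fun x => (I.filter fun v => v ≤ γ x).card with hκ
  have hκle : ∀ x ≤ d, κ x ≤ x := by
    intro x hx
    have hsub : I.filter (fun v => v ≤ γ x) ⊆ (Finset.Icc 1 x).image γ := by
      intro v hv
      rw [Finset.mem_filter, hI, Finset.mem_filter, Finset.mem_image] at hv
      obtain ⟨⟨⟨y, hy, rfl⟩, h1⟩, h2⟩ := hv
      rw [Finset.mem_image]
      rw [Finset.mem_range] at hy
      by_cases hyx : y ≤ x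
      · refine ⟨y, Finset.mem_Icc.2 ⟨?_, hyx⟩, rfl⟩
        by_contra hy0
        obtain rfl : y = 0 := by omega
        omega
      · have h3 := hmono x y (by omega) (by omega)
        refine ⟨x, Finset.mem_Icc.2 ⟨?_, le_rfl⟩, by omega⟩
        by_contra hx0
        obtain rfl : x = 0 := by omega
        omega
    calc κ x ≤ ((Finset.Icc 1 x).image γ).card := Finset.card_le_card hsub
      _ ≤ (Finset.Icc 1 x).card := Finset.card_image_le
      _ = x := by simp
  have hκmono : ∀ x y, γ x ≤ γ y → κ x ≤ κ y := by
    intro x y h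
    refine Finset.card_le_card fun v hv => ?_
    rw [Finset.mem_filter] at hv ⊢
    exact ⟨hv.1, hv.2.trans h⟩
  have hκlt : ∀ x y, y ≤ d + 1 → γ x < γ y → κ x < κ y := by
    intro x y hy h
    refine Finset.card_lt_card (Finset.ssubset_iff_of_subset ?_ |>.2 ⟨γ y, ?_, ?_⟩)
    · intro v hv
      rw [Finset.mem_filter] at hv ⊢
      exact ⟨hv.1, hv.2.trans h.le⟩
    · exact Finset.mem_filter.2 ⟨hmemI y hy (by omega), le_rfl⟩
    · rw [Finset.mem_filter]
      omega
  have hκ0 : κ 0 = 0 := by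
    have := hκle 0 (Nat.zero_le d)
    omega
  have hIcard : I.card ≤ d + 1 := by
    have h : I ⊆ Finset.Icc 1 (d + 1) := fun v hv => Finset.mem_Icc.2 (hIle v hv)
    simpa using Finset.card_le_card h
  have hκtop : κ (d + 1) = I.card := by
    rw [hκ]
    dsimp only
    rw [Finset.filter_true_of_mem]
    intro v hv
    rw [htop]
    exact (hIle v hv).2
  have hκge : ∀ x ≤ d, γ x + I.card ≤ κ x + (d + 1) := by
    intro x hx
    have h1 := Finset.card_filter_add_card_filter_not (s := I) (fun v => v ≤ γ x)
    have h2 : (I.filter fun v => ¬ v ≤ γ x) ⊆ Finset.Ioc (γ x) (d + 1) := by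
      intro v hv
      rw [Finset.mem_filter] at hv
      rw [Finset.mem_Ioc]
      exact ⟨by omega, (hIle v hv.1).2⟩
    have h3 := Finset.card_le_card h2
    rw [Nat.card_Ioc] at h3
    have h4 := hdom x (by omega)
    have h5 : κ x = (I.filter fun v => v ≤ γ x).card := rfl
    omega
  set t := d + 1 - I.card with ht
  set e : ℕ → ℕ := fun x => shiftBy d t (κ x) with he
  have heq : ∀ x, e x = if κ x = 0 then 0 else min (κ x + t) (d + 1) := fun x => rfl
  have hge : ∀ x ≤ d, γ x ≤ e x := by
    intro x hx
    have h1 := hκge x hx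
    have h2 := hdom x (by omega)
    have h3 := hκlt 0 x (by omega)
    rw [heq]
    split_ifs <;> omega
  have hreflect : ∀ x y, x ≤ d → y ≤ d → e x ≤ e y → γ x ≤ γ y := by
    intro x y hx hy h
    by_contra hlt
    have h1 := hκlt y x (by omega) (by omega)
    have h2 : κ x ≤ κ (d + 1) := hκmono x (d + 1) (by rw [htop]; exact hdom x (by omega))
    rw [heq, heq] at h
    split_ifs at h <;> omega
  refine ⟨κ, fun y => ((Finset.range (d + 1)).filter fun x => e x ≤ y).sup γ, t, hκle,
    fun x y hxy hy => hκmono x y (hmono x y hxy (by omega)), ?_, ?_, ?_⟩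
  · intro y _
    refine Finset.sup_le fun x hx => ?_
    rw [Finset.mem_filter, Finset.mem_range] at hx
    exact (hge x (by omega)).trans hx.2
  · intro y z hyz _
    refine Finset.sup_mono fun x hx => ?_
    rw [Finset.mem_filter] at hx ⊢
    exact ⟨hx.1, hx.2.trans hyz⟩
  · intro x hx
    change (e x ≤ d ∧ _) ∨ (e x = d + 1 ∧ _)
    by_cases hγ : γ x = d + 1
    · have h1 := hge x hx
      have h2 : e x ≤ d + 1 := by
        rw [heq]
        split_ifs <;> omega
      exact Or.inr ⟨by omega, hγ⟩
    · have h1 := hdom x (by omega)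
      have h2 := hκlt x (d + 1) le_rfl (by omega)
      refine Or.inl ⟨?_, le_antisymm ?_ ?_⟩
      · rw [heq]
        split_ifs <;> omega
      · refine Finset.sup_le fun y hy => ?_
        rw [Finset.mem_filter, Finset.mem_range] at hy
        exact hreflect y x (by omega) hx hy.2
      · refine Finset.le_sup (f := γ) ?_
        rw [Finset.mem_filter, Finset.mem_range]
        exact ⟨by omega, le_rfl⟩

theorem exists_iterComp_eq {d : ℕ} (hd : 1 ≤ d) {γ : ℕ → ℕ}
    (hdom : ∀ x ≤ d + 1, γ x ≤ d + 1)
    (hmono : ∀ x y : ℕ, x ≤ y → y ≤ d + 1 → γ x ≤ γ y)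
    (h0 : γ 0 = 0) (htop : γ (d + 1) = d + 1) :
    ∃ (m : ℕ) (f : ℕ → ℕ → ℕ), 1 ≤ m ∧ m ≤ d ^ 3 ∧ (∀ j < m, IsPieceFun d (f j)) ∧
      ∀ x ≤ d, iterComp f m x = γ x := by
  rcases hd.eq_or_lt with rfl | hd
  · have h1 := hdom 1 (by omega)
    have key : ∀ g : ℕ → ℕ, IsPieceFun 1 g → g 0 = 0 → g 1 = γ 1 →
        ∃ (m : ℕ) (f : ℕ → ℕ → ℕ), 1 ≤ m ∧ m ≤ 1 ^ 3 ∧ (∀ j < m, IsPieceFun 1 (f j)) ∧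
          ∀ x ≤ 1, iterComp f m x = γ x := by
      intro g hg hg0 hg1
      refine ⟨1, fun _ => g, le_rfl, le_rfl, fun _ _ => hg, fun x hx => ?_⟩
      change g x = γ x
      interval_cases x
      · rw [hg0, h0]
      · exact hg1
    interval_cases h : γ 1
    · exact key _ (isPieceFun_decIJ (i := 0) (j := 1) (by omega) le_rfl) rfl rfl
    · exact key _ (isPieceFun_decIJ (i := 0) (j := 0) le_rfl (by omega)) rfl rfl
    · exact key _ (isPieceFun_shiftBy 1 1) rfl rfl
  · obtain ⟨κ, ℓ, t, hκ, hκmono, hℓ, hℓmono, h⟩ :=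
      exists_shift_factorization hdom hmono h0 htop
    refine ⟨d + 1 + d, fun j => if j < d then decIJ (κ (j + 1)) (j + 1) else
      if j = d then shiftBy d t else decIJ (ℓ (j - (d + 1) + 1)) (j - (d + 1) + 1),
      by omega, ?_, ?_, ?_⟩
    · nlinarith [Nat.mul_le_mul hd hd, Nat.mul_le_mul hd (Nat.mul_le_mul hd (le_refl d))]
    · intro j hj
      dsimp only
      split_ifs with h1 h2
      · exact isPieceFun_decIJ (hκ _ h1) h1
      · exact isPieceFun_shiftBy d t
      · exact isPieceFun_decIJ (hℓ _ (by omega)) (by omega)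
    · intro x hx
      rw [iterComp_add, iterComp,
        iterComp_congr (g := fun j => decIJ (ℓ (j + 1)) (j + 1)) fun j hj => by
          simp [show ¬ d + 1 + j < d by omega, show d + 1 + j ≠ d by omega],
        iterComp_decIJ hℓ hℓmono le_rfl,
        iterComp_congr (g := fun j => decIJ (κ (j + 1)) (j + 1)) fun j hj => by simp [hj],
        iterComp_decIJ hκ hκmono le_rfl, if_neg (lt_irrefl d), if_pos rfl, if_pos hx]
      rcases h x hx with ⟨h1, h2⟩ | ⟨h1, h2⟩
      · rw [if_pos h1, h2]
      · rw [h1, if_neg (by omega), h2]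

end Pieces

namespace IsLeveledCaterpillar

variable {G : SimpleGraph V} {d m n : ℕ} {μ s : ℕ → ℕ} {lv : V → ℕ} {sp : ℕ → V}
  {f : ℕ → ℕ → ℕ}

theorem adj_sp_lv (M : IsLeveledCaterpillar G n μ lv sp) {v : V} (h1 : 1 ≤ lv v)
    (hv : v ≠ sp (lv v)) : G.Adj v (sp (lv v)) :=
  (M.adj_iff _ _).2 (Or.inr ⟨lv v, h1, M.lv_le v, rfl, Or.inl ⟨rfl, hv⟩⟩)

/-- A leveled caterpillar with empty level `0`, as a caterpillar with a fixed spine. -/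
def toSubCaterpillar (M : IsLeveledCaterpillar G n μ lv sp) (hn : 0 < n)
    (h0 : ∀ u, 1 ≤ lv u) : SubCaterpillar G where
  verts := Set.univ
  n := n
  npos := hn
  spine i := sp (i + 1)
  spineMem _ := trivial
  spineInj i j h := by
    have hi := M.lv_sp (i + 1) (by omega) (by omega)
    have hj := M.lv_sp (j + 1) (by omega) (by omega)
    dsimp only at h
    rw [h] at hi
    exact Fin.ext (Nat.succ.inj (hi.symm.trans hj))
  spineAdj i h := M.adj_sp_succ (k := i + 1) (by omega) h
  isTree := by
    have : Nonempty V := ⟨sp 1⟩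
    exact (induceUnivIso G).isTree_iff.2 ⟨M.connected hn, M.isAcyclic h0⟩
  pendant v _ hv := by
    have hle := M.lv_le v
    have h1 := h0 v
    have hne : v ≠ sp (lv v) := by
      rintro h
      refine hv ⟨⟨lv v - 1, by omega⟩, ?_⟩
      dsimp only
      rw [Nat.sub_add_cancel h1, ← h]
    rw [Set.ncard_eq_one]
    refine ⟨sp (lv v), Set.ext fun w => ?_⟩
    constructor
    · rintro ⟨-, h⟩
      exact M.eq_sp_of_adj_pendant h1 hne h
    · rintro rfl
      exact ⟨trivial, M.adj_sp_lv h1 hne⟩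

/-- The `j`-th piece is destroyed by deleting its rightmost spine vertex. -/
theorem isCocSetOn_piece [Finite V] (M : IsLeveledCaterpillar G n μ lv sp)
    (L : Layout d m n μ s f) (hd : 1 ≤ d) (h0 : ∀ u, 1 ≤ lv u) {j : ℕ} (hj : j < m) :
    IsCocSetOn G {u | s j ≤ lv u ∧ lv u < s (j + 1)} d {sp (s (j + 1) - 1)} := by
  have P := L.piece j hj
  have hlt := P.lt
  have hle := L.le_of_le (show j + 1 ≤ m from hj)
  have h1 := L.one_le j
  rw [isCocSetOn_iff_compSizeOn_le]
  intro v
  by_cases hv : v ∈ {u | s j ≤ lv u ∧ lv u < s (j + 1)} \ {sp (s (j + 1) - 1)}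
  swap
  · rw [compSizeOn_eq_zero hv]
    exact Nat.zero_le d
  obtain ⟨⟨ha, hb⟩, hne⟩ := hv
  rw [Set.mem_singleton_iff] at hne
  by_cases htop : lv v = s (j + 1) - 1
  · refine (M.compSizeOn_pendant_le_one (h0 v) (by rwa [htop]) ?_).trans hd
    rw [htop]
    exact fun h => h.2 rfl
  · refine (M.compSizeOn_le_ncard_levels (a := s j) (b := s (j + 1) - 1) ?_ ?_ ha
      (by omega)).trans ?_
    · right
      rintro u ⟨⟨hu, -⟩, -⟩ hu'
      omega
    · rintro u ⟨-, hu⟩ -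
      exact hu
    · rw [M.ncard_levels (by omega) (by omega)]
      exact P.sum_le

theorem connected_piece [Finite V] (M : IsLeveledCaterpillar G n μ lv sp)
    (L : Layout d m n μ s f) {j : ℕ} (hj : j < m) :
    (G.induce {u | s j ≤ lv u ∧ lv u < s (j + 1)}).Connected := by
  have hlt := (L.piece j hj).lt
  have hle := L.le_of_le (show j + 1 ≤ m from hj)
  have h1 := L.one_le j
  have hB : ∀ k, s j ≤ k → 1 ≤ k → k ≤ s (j + 1) - 1 →
      sp k ∈ {u | s j ≤ lv u ∧ lv u < s (j + 1)} := by
    intro k hk hk1 hk'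
    change s j ≤ lv (sp k) ∧ lv (sp k) < s (j + 1)
    rw [M.lv_sp k hk1 (by omega)]
    omega
  have key : ∀ u (hu : u ∈ {u | s j ≤ lv u ∧ lv u < s (j + 1)}),
      (G.induce {u | s j ≤ lv u ∧ lv u < s (j + 1)}).Reachable ⟨u, hu⟩
        ⟨sp (s (j + 1) - 1), hB _ (by omega) (by omega) le_rfl⟩ := by
    intro u hu
    have hu2 : lv u < s (j + 1) := hu.2
    exact M.reachable_induce (a := s j) (by omega) (by omega) hB hu hu.1 (by omega) (by omega)
  exact { preconnected := fun u w => (key u.1 u.2).trans (key w.1 w.2).symm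
          nonempty := ⟨⟨_, hB (s j) le_rfl h1 (by omega)⟩⟩ }

theorem cocOptOn_eq [Finite V] (M : IsLeveledCaterpillar G n μ lv sp)
    (L : Layout d m n μ s f) (hd : 1 ≤ d) (hn : 1 ≤ n) (h0 : μ 0 = 0) :
    cocOptOn G Set.univ d = m := by
  rw [M.cocOptOn_eq_iff L hd hn (by omega), h0, L.iterComp_zero le_rfl]
  exact Nat.zero_le d

/-- The pieces of a layout form a solution-tight packing covering all vertices. -/
theorem exists_isSTP [Finite V] (M : IsLeveledCaterpillar G n μ lv sp)
    (L : Layout d m n μ s f) (hd : 1 ≤ d) (hn : 0 < n) (h0 : μ 0 = 0) (hlv : ∀ u, 1 ≤ lv u) :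
    ∃ Q : Finset (Set V), IsSTP G d (M.toSubCaterpillar hn hlv) Q ∧ Q.card = m ∧
      ⋃₀ (↑Q : Set (Set V)) = Set.univ := by
  classical
  set B : ℕ → Set V := fun j => {u | s j ≤ lv u ∧ lv u < s (j + 1)} with hB
  have hspB : ∀ k, 1 ≤ k → k ≤ n → ∀ j, sp k ∈ B j ↔ s j ≤ k ∧ k < s (j + 1) := by
    intro k h1 hk j
    change s j ≤ lv (sp k) ∧ lv (sp k) < s (j + 1) ↔ _
    rw [M.lv_sp k h1 hk]
  have hdisj : ∀ i j, i ≠ j → Disjoint (B i) (B j) := by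
    intro i j hij
    rw [Set.disjoint_left]
    intro u hi hj
    exact hij (L.piece_unique hi.1 hi.2 hj.1 hj.2)
  have hne : ∀ j < m, (B j).Nonempty := by
    intro j hj
    have hlt := (L.piece j hj).lt
    have hle := L.le_of_le (show j + 1 ≤ m from hj)
    exact ⟨sp (s j), (hspB _ (L.one_le j) (by omega) j).2 ⟨le_rfl, hlt⟩⟩
  have hinj : Set.InjOn B (Finset.range m : Set ℕ) := by
    intro i hi j hj hij
    by_contra h
    have h' := hdisj i j h
    rw [← hij, disjoint_self] at h'
    exact (hne i (by simpa using hi)).ne_empty h'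
  have hcard : ((Finset.range m).image B).card = m := by
    rw [Finset.card_image_of_injOn hinj, Finset.card_range]
  have hcover : ∀ u, ∃ j < m, u ∈ B j := fun u => L.exists_piece (hlv u) (M.lv_le u)
  refine ⟨(Finset.range m).image B, ⟨?_, ?_, ?_, ?_, ?_, ?_⟩, hcard, ?_⟩
  · intro A hA
    obtain ⟨j, hj, rfl⟩ := Finset.mem_image.1 hA
    rw [Finset.mem_range] at hj
    have P := L.piece j hj
    refine ⟨Set.subset_univ _, ?_, M.connected_piece L hj⟩
    rw [hB]
    dsimp only
    rw [M.ncard_levels P.lt.le (L.le_of_le hj)]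
    exact P.le_sum
  · intro A hA A' hA' hAA'
    obtain ⟨i, -, rfl⟩ := Finset.mem_image.1 (Finset.mem_coe.1 hA)
    obtain ⟨j, -, rfl⟩ := Finset.mem_image.1 (Finset.mem_coe.1 hA')
    exact hdisj i j fun h => hAA' (by rw [h])
  · rw [hcard]
    exact (M.cocOptOn_eq L hd hn h0).symm
  · intro A hA v _ hv w hw hvw
    obtain ⟨j, -, rfl⟩ := Finset.mem_image.1 hA
    have hle := M.lv_le v
    have h1 := hlv v
    have hne : v ≠ sp (lv v) := by
      intro h
      refine hv ⟨⟨lv v - 1, show lv v - 1 < n by omega⟩, ?_⟩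
      change sp (lv v - 1 + 1) = v
      rw [Nat.sub_add_cancel h1, ← h]
    rw [M.eq_sp_of_adj_pendant h1 hne hvw, hspB _ h1 hle] at hw
    exact hw
  · refine ⟨n, le_rfl, fun j => iff_of_true j.2 ?_⟩
    obtain ⟨i, hi, h⟩ := hcover ((M.toSubCaterpillar hn hlv).spine j)
    exact ⟨B i, Finset.mem_image_of_mem B (Finset.mem_range.2 hi), h⟩
  · intro A hA k hk hmax
    obtain ⟨j, hj, rfl⟩ := Finset.mem_image.1 hA
    rw [Finset.mem_range] at hj
    have hlt := (L.piece j hj).lt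
    have hle := L.le_of_le (show j + 1 ≤ m from hj)
    have hs := L.one_le j
    have hkn : (k : ℕ) < n := k.2
    have h1 : s j ≤ k + 1 ∧ k + 1 < s (j + 1) := (hspB (k + 1) (by omega) hkn j).1 hk
    have h2 := hmax ⟨s (j + 1) - 2, show s (j + 1) - 2 < n by omega⟩
      ((hspB (s (j + 1) - 2 + 1) (by omega) (by omega) j).2 (by omega))
    dsimp only at h2
    have h3 : (M.toSubCaterpillar hn hlv).spine k = sp (s (j + 1) - 1) := by
      change sp (k + 1) = _
      congr 1
      omega
    rw [h3]
    exact M.isCocSetOn_piece L hd hlv hj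
  · refine Set.eq_univ_of_forall fun u => ?_
    obtain ⟨j, hj, hu⟩ := hcover u
    exact ⟨B j, Finset.mem_coe.2 (Finset.mem_image_of_mem B (Finset.mem_range.2 hj)), hu⟩

theorem essence_eq [Finite V] (M : IsLeveledCaterpillar G n μ lv sp)
    (L : Layout d m n μ s f) (hd : 1 ≤ d) (hn : 0 < n) (h0 : μ 0 = 0) (hlv : ∀ u, 1 ≤ lv u)
    {x : ℕ} (hx : x ≤ d) :
    (M.toSubCaterpillar hn hlv).essence d x = iterComp f m x := by
  have M' := M.attachPendants_induce (v := ⟨sp 1, trivial⟩) h0 hn rfl x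
  have L' : Layout d m n (Function.update μ 0 x) s f :=
    L.congr fun k hk => Function.update_of_ne (by omega) _ _
  have hopt := M'.cocOptOn_eq_iff L' hd hn (by rwa [Function.update_self])
  have hsInf := M'.sInf_compSizeOn_eq L' hd hn (by rwa [Function.update_self])
  rw [Function.update_self] at hopt hsInf
  have hlast : (Sum.inl ⟨sp n, trivial⟩ : ↥(Set.univ : Set V) ⊕ Fin x) =
      Sum.inl ⟨sp (n - 1 + 1), trivial⟩ := by
    rw [Nat.sub_add_cancel hn]
  rw [hlast] at hsInf
  have hle := L.iterComp_le (x := x) le_rfl (by omega)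
  rw [SubCaterpillar.essence]
  by_cases h : iterComp f m x ≤ d
  · rw [if_pos ⟨hx, (hopt.2 h).trans (M.cocOptOn_eq L hd hn h0).symm⟩]
    exact hsInf h
  · rw [if_neg fun h' => h (hopt.1 (h'.2.trans (M.cocOptOn_eq L hd hn h0)))]
    omega

end IsLeveledCaterpillar

theorem exists_isLeveledCaterpillar {n : ℕ} {μ : ℕ → ℕ} (hn : 1 ≤ n) (h0 : μ 0 = 0)
    (hμ : ∀ k, 1 ≤ k → k ≤ n → 1 ≤ μ k) :
    ∃ (V : Type) (_ : Fintype V) (G : SimpleGraph V) (lv : V → ℕ) (sp : ℕ → V),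
      IsLeveledCaterpillar G n μ lv sp := by
  let V := (i : Fin n) × Fin (μ (i + 1))
  let lv : V → ℕ := fun v => v.1 + 1
  let sp : ℕ → V := fun k =>
    if h : 1 ≤ k ∧ k ≤ n then
      ⟨⟨k - 1, by omega⟩, ⟨0, by
        dsimp only
        rw [Nat.sub_add_cancel h.1]
        exact hμ k h.1 h.2⟩⟩
    else ⟨⟨0, hn⟩, ⟨0, hμ 1 le_rfl hn⟩⟩
  have hsp : ∀ k, 1 ≤ k → k ≤ n → lv (sp k) = k := by
    intro k h1 hk
    simp only [lv, sp, dif_pos (And.intro h1 hk)]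
    omega
  refine ⟨V, inferInstance, fromRel (LevelEdge n lv sp), lv, sp, fun v => v.1.2, hsp, ?_, ?_⟩
  · intro u v
    rw [fromRel_adj, and_iff_right_iff_imp]
    rintro h rfl
    rw [or_self] at h
    obtain ⟨k, h1, hk, rfl, ⟨-, h⟩ | ⟨h, -⟩ | ⟨h, h'⟩⟩ := h
    · exact h rfl
    · rw [hsp k h1 hk] at h
      omega
    · have h2 := hsp k h1 hk
      rw [h', hsp (k + 1) (by omega) h] at h2
      omega
  · intro k hk
    rcases Nat.eq_zero_or_pos k with rfl | hpos
    · rw [h0, Set.ncard_eq_zero (Set.toFinite _)]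
      ext v
      simp [lv]
    · obtain ⟨k, rfl⟩ := Nat.exists_eq_add_of_le' hpos
      have : {u : V | lv u = k + 1} = Set.range fun a : Fin (μ (k + 1)) => (⟨⟨k, hk⟩, a⟩ : V) := by
        ext ⟨⟨i, hi⟩, a⟩
        constructor
        · intro h
          obtain rfl : i = k := Nat.succ.inj h
          exact ⟨a, rfl⟩
        · rintro ⟨b, hb⟩
          rw [← hb]
          rfl
      have hinj : Function.Injective fun a : Fin (μ (k + 1)) => (⟨⟨k, hk⟩, a⟩ : V) :=
        fun a b hab => eq_of_heq (Sigma.mk.inj hab).2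
      rw [this, ← Set.image_univ, Set.ncard_image_of_injective _ hinj, Set.ncard_univ,
        Nat.card_fin]

/-- Let `d ≥ 1` and `γ : {0,…,d+1} → {0,…,d+1}` any non-decreasing
function with `γ 0 = 0` and `γ (d+1) = d+1`. Then there is a caterpillar `C` whose
essence relative to `d` equals `γ`, such that the solution-tight packing `𝒞` of `C`
contains all vertices of `C` and `|𝒞| ≤ d³`. -/
theorem stmt14 (d : ℕ) (hd : 1 ≤ d) (γ : ℕ → ℕ)
    (hdom : ∀ x ≤ d + 1, γ x ≤ d + 1)
    (hmono : ∀ x y : ℕ, x ≤ y → y ≤ d + 1 → γ x ≤ γ y)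
    (h0 : γ 0 = 0) (htop : γ (d + 1) = d + 1) :
    ∃ (V : Type) (_ : Fintype V) (H : SimpleGraph V) (C : SubCaterpillar H),
      C.verts = Set.univ ∧
      (∃ Q : Finset (Set V), IsSTP H d C Q ∧ Q.card ≤ d ^ 3 ∧
        ⋃₀ (↑Q : Set (Set V)) = C.verts) ∧
      ∀ x ≤ d + 1, C.essence d x = γ x := by
  obtain ⟨m, f, hm, hmd, hf, hγ⟩ := exists_iterComp_eq hd hdom hmono h0 htop
  obtain ⟨n, μ, s, L, hμ⟩ := exists_layout hf
  have hn : 1 ≤ n := by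
    have h1 : s 0 < s 1 := (L.piece 0 hm).lt
    have h2 := L.le_of_le hm
    have h3 := L.zero
    omega
  obtain ⟨V, _, G, lv, sp, M⟩ := exists_isLeveledCaterpillar hn hμ L.pos
  have hlv := M.one_le_lv hμ
  obtain ⟨Q, hQ, hcard, hcover⟩ := M.exists_isSTP L hd hn hμ hlv
  refine ⟨V, inferInstance, G, M.toSubCaterpillar hn hlv, rfl,
    ⟨Q, hQ, hcard.trans_le hmd, hcover⟩, fun x hx => ?_⟩
  rcases Nat.lt_or_ge d x with h | h
  · obtain rfl : x = d + 1 := by omega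
    rw [htop, SubCaterpillar.essence, if_neg fun h' => by omega]
  · rw [M.essence_eq L hd hn hμ hlv h, hγ x h]

end CocPaper
end
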